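/- arXiv:1905.08532 — 6 statements merged into one kernel-verified Lean document; each statement's English description precedes it below -/
import Mathlib

section
/- Let n ≥ 3 be an odd integer and k ≥ 2 an even integer, set K = k(k+n−1), a = 2n(n/K − 1) and b = −(n+1). Then b² + 4a = n² − 6n + 1 + 8n²/K, the trace b is negative, the determinant −a is positive, and b² + 4a < 0 if and only if (n = 3 and k ≥ 4) or (n = 5 and k ≥ 6). Equivalently, the eigenvalues of the matrix B = [[0,1],[a,b]] form a complex conjugate pair with negative real part exactly when (n = 3 and k ≥ 4) or (n = 5 and k ≥ 6), and otherwise are two negative real numbers. -/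
/-- Discriminant analysis of the linearization matrix `B = [[0,1],[a,b]]` of
(ODE2) at `(φ₀,0)` (equations (3.24)–(3.26) of Xu–Yang–Zhang): with
`K = k(k+n-1)`, `a = 2n(n/K - 1)` and `b = -(n+1)` one has
`b² + 4a = n² - 6n + 1 + 8n²/K`, the trace `b` is negative, the determinant `-a`
is positive, and `b² + 4a < 0` (complex conjugate eigenvalues with negative real
part, i.e. Type (II)) exactly when `(n,k ≥ 4) = (3,·)` or `(n,k ≥ 6) = (5,·)`. -/
theorem linearization_at_phi0_discriminant (n k : ℕ) (hn : 3 ≤ n) (hodd : Odd n)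
    (hk : 2 ≤ k) (heven : Even k)
    (K a b : ℝ) (hK : K = (k : ℝ) * ((k : ℝ) + n - 1))
    (ha : a = 2 * n * ((n : ℝ) / K - 1)) (hb : b = -((n : ℝ) + 1)) :
    b ^ 2 + 4 * a = (n : ℝ) ^ 2 - 6 * n + 1 + 8 * n ^ 2 / K ∧
    b < 0 ∧ 0 < -a ∧
    (Matrix.trace !![(0 : ℝ), 1; a, b] = b ∧ Matrix.det !![(0 : ℝ), 1; a, b] = -a) ∧
    (b ^ 2 + 4 * a < 0 ↔ ((n = 3 ∧ 4 ≤ k) ∨ (n = 5 ∧ 6 ≤ k))) := by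
  have hn' : (3 : ℝ) ≤ n := by exact_mod_cast hn
  have hk' : (2 : ℝ) ≤ k := by exact_mod_cast hk
  have hnK : (n : ℝ) < K := by rw [hK]; nlinarith
  have hK0 : 0 < K := by linarith
  have hdisc : b ^ 2 + 4 * a = (n : ℝ) ^ 2 - 6 * n + 1 + 8 * n ^ 2 / K := by
    rw [ha, hb]; ring
  refine ⟨hdisc, by linarith, ?_, ⟨by simp [Matrix.trace_fin_two],
    by simp [Matrix.det_fin_two]⟩, ?_⟩
  · have h : (n : ℝ) / K < 1 := (div_lt_one hK0).2 hnK
    rw [ha]; nlinarith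
  have hneg : b ^ 2 + 4 * a < 0 ↔ ((n : ℝ) ^ 2 - 6 * n + 1) * K + 8 * n ^ 2 < 0 := by
    have h : (n : ℝ) ^ 2 - 6 * n + 1 + 8 * n ^ 2 / K =
        (((n : ℝ) ^ 2 - 6 * n + 1) * K + 8 * n ^ 2) / K := by
      field_simp
    rw [hdisc, h, div_lt_iff₀ hK0, zero_mul]
  rw [hneg, hK]
  obtain rfl | rfl | h7 : n = 3 ∨ n = 5 ∨ 7 ≤ n := by
    obtain ⟨m, rfl⟩ := hodd
    omega
  · constructor
    · intro h
      refine Or.inl ⟨rfl, ?_⟩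
      by_contra hlt
      obtain rfl : k = 2 := by
        obtain ⟨m, rfl⟩ := heven
        omega
      norm_num at h
    · rintro (⟨-, h4⟩ | ⟨h, -⟩)
      · have h4' : (4 : ℝ) ≤ k := by exact_mod_cast h4
        push_cast
        nlinarith
      · omega
  · constructor
    · intro h
      refine Or.inr ⟨rfl, ?_⟩
      by_contra hlt
      obtain rfl | rfl : k = 2 ∨ k = 4 := by
        obtain ⟨m, rfl⟩ := heven
        omega
      all_goals norm_num at h
    · rintro (⟨h, -⟩ | ⟨-, h6⟩)
      · omega
      · have h6' : (6 : ℝ) ≤ k := by exact_mod_cast h6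
        push_cast
        nlinarith
  · have h7' : (7 : ℝ) ≤ n := by exact_mod_cast h7
    refine iff_of_false (not_lt.2 ?_) (by omega)
    rw [← hK]
    have hcoeff : 0 ≤ (n : ℝ) ^ 2 - 6 * n + 1 := by nlinarith
    positivity
end

section
/- Suppose (n, p, k) ∈ {(3,2,2), (5,4,2), (5,4,4)}, or n ≥ 7 with p < n < 2p, p ≥ 4 and k ≥ 2. Let λ = √(k(k+n−1)/p) and φ₀ = √((p − n/λ²)/(n−p)). Then there exists a continuously differentiable solution t ∈ ℝ ↦ (φ(t), ψ(t)) of (ODE2) defined on all of ℝ such that: (φ(t), ψ(t)) → (0, 0) as t → −∞; there exist C > 0 and T ∈ ℝ with |φ(t)| ≤ C·e^{(k−1)t} and |ψ(t)| ≤ C·e^{(k−1)t} for all t ≤ T; (φ(t), ψ(t)) → (φ₀, 0) as t → +∞; φ is strictly increasing on ℝ; and ψ(t) > 0 for every t ∈ ℝ. -/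
/-- `f₁(φ) = (λ²-1)p/(1+λ²φ²) - (n-p)`. -/
noncomputable def f1 (n p : ℕ) (lam φ : ℝ) : ℝ :=
  (lam ^ 2 - 1) * p / (1 + lam ^ 2 * φ ^ 2) - ((n : ℝ) - p)

/-- `f₂(φ) = (n-p) + p/(1+λ²φ²)`. -/
noncomputable def f2 (n p : ℕ) (lam φ : ℝ) : ℝ :=
  ((n : ℝ) - p) + (p : ℝ) / (1 + lam ^ 2 * φ ^ 2)

/-- Second component of the vector field of the autonomous system (ODE2). -/
noncomputable def X2 (n p : ℕ) (lam φ ψ : ℝ) : ℝ :=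
  -ψ - (f2 n p lam φ * ψ - f1 n p lam φ * φ) * (1 + (φ + ψ) ^ 2)

section Heteroclinic

open Set Filter Topology NNReal

section GlobalFlow

variable {E : Type*} [NormedAddCommGroup E] [NormedSpace ℝ E]

/-- A bounded, globally Lipschitz vector field has a solution on all of `ℝ` through each point. -/
theorem exists_global_solution [CompleteSpace E] {v : E → E} {K C : ℝ≥0} (hv : LipschitzWith K v)
    (hC : ∀ x, ‖v x‖ ≤ C) (x₀ : E) :
    ∃ γ : ℝ → E, γ 0 = x₀ ∧ ∀ t, HasDerivAt γ (v (γ t)) t := by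
  have hloc (N : ℕ) : ∃ α : ℝ → E, α 0 = x₀ ∧
      ∀ t ∈ Ioo (-(N + 1) : ℝ) (N + 1), HasDerivAt α (v (α t)) t := by
    have h0 : (0 : ℝ) ∈ Icc (-(N + 1) : ℝ) (N + 1) := ⟨by linarith, by positivity⟩
    have hpl : IsPicardLindelof (fun _ => v) ⟨0, h0⟩ x₀ (C * (N + 1)) 0 C K :=
      .of_time_independent (fun x _ => hC x) hv.lipschitzOnWith (by simp)
    obtain ⟨α, hα0, hα⟩ := hpl.exists_eq_forall_mem_Icc_hasDerivWithinAt₀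
    exact ⟨α, hα0, fun t ht =>
      (hα t (Ioo_subset_Icc_self ht)).hasDerivAt (Icc_mem_nhds ht.1 ht.2)⟩
  choose α hα0 hα using hloc
  have hagree {M N : ℕ} (hMN : M ≤ N) {t : ℝ} (ht : t ∈ Ioo (-(M + 1) : ℝ) (M + 1)) :
      α M t = α N t := by
    have hMN' : (M : ℝ) ≤ N := by exact_mod_cast hMN
    refine ODE_solution_unique_of_mem_Ioo (v := fun _ => v) (s := fun _ => univ) (K := K)
      (t₀ := 0) (fun _ _ => hv.lipschitzOnWith) ⟨by linarith, by positivity⟩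
      (fun s hs => ⟨hα M s hs, trivial⟩)
      (fun s hs => ⟨hα N s ⟨by linarith [hs.1], by linarith [hs.2]⟩, trivial⟩)
      (by rw [hα0, hα0]) ht
  refine ⟨fun t => α ⌈|t|⌉₊ t, by simp [hα0], fun t => ?_⟩
  have hmem (s : ℝ) : s ∈ Ioo (-(⌈|s|⌉₊ + 1) : ℝ) (⌈|s|⌉₊ + 1) := by
    have := abs_le.1 (Nat.le_ceil |s|)
    exact ⟨by linarith [this.1], by linarith [this.2]⟩
  have heq : (fun s => α ⌈|s|⌉₊ s) =ᶠ[𝓝 t] α (⌈|t|⌉₊ + 1) := by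
    have : ∀ᶠ s in 𝓝 t, |s| < |t| + 1 := continuous_abs.continuousAt.eventually_lt
      continuousAt_const (by linarith)
    filter_upwards [this] with s hs
    refine hagree (Nat.ceil_le.2 ?_) (hmem s)
    push_cast
    linarith [Nat.le_ceil |t|]
  have hd := hα (⌈|t|⌉₊ + 1) t ⟨by have := (hmem t).1; push_cast; linarith,
    by have := (hmem t).2; push_cast; linarith⟩
  rw [← heq.eq_of_nhds] at hd
  exact hd.congr_of_eventuallyEq heq

/-- Grönwall estimate, in both time directions, for an autonomous Lipschitz equation. -/
theorem dist_solution_le {v : E → E} {K : ℝ≥0} (hv : LipschitzWith K v) {γ η : ℝ → E}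
    (hγ : ∀ t, HasDerivAt γ (v (γ t)) t) (hη : ∀ t, HasDerivAt η (v (η t)) t) (t : ℝ) :
    dist (γ t) (η t) ≤ dist (γ 0) (η 0) * Real.exp (K * |t|) := by
  have key {w : E → E} (hw : LipschitzWith K w) {γ η : ℝ → E}
      (hγ : ∀ t, HasDerivAt γ (w (γ t)) t) (hη : ∀ t, HasDerivAt η (w (η t)) t) {t : ℝ}
      (ht : 0 ≤ t) : dist (γ t) (η t) ≤ dist (γ 0) (η 0) * Real.exp (K * |t|) := by
    rw [abs_of_nonneg ht]
    have := dist_le_of_trajectories_ODE (v := fun _ => w) (a := 0) (b := t) (fun _ => hw)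
      (fun s _ => (hγ s).continuousAt.continuousWithinAt) (fun s _ => (hγ s).hasDerivWithinAt)
      (fun s _ => (hη s).continuousAt.continuousWithinAt) (fun s _ => (hη s).hasDerivWithinAt)
      le_rfl t ⟨ht, le_rfl⟩
    rwa [sub_zero] at this
  rcases le_total 0 t with ht | ht
  · exact key hv hγ hη ht
  · have hrev {γ : ℝ → E} (hγ : ∀ t, HasDerivAt γ (v (γ t)) t) (s : ℝ) :
        HasDerivAt (fun s => γ (-s)) (-v (γ (-s))) s := by
      simpa [Function.comp_def] using (hγ (-s)).scomp s (hasDerivAt_neg s)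
    have := key (w := fun x => -v x) hv.neg (hrev hγ) (hrev hη) (neg_nonneg.2 ht)
    simpa using this

/-- Solutions whose initial values converge, converge at every time. -/
theorem tendsto_solution {v : E → E} {K : ℝ≥0} (hv : LipschitzWith K v) {γ : ℕ → ℝ → E}
    {η : ℝ → E} (hγ : ∀ j t, HasDerivAt (γ j) (v (γ j t)) t) (hη : ∀ t, HasDerivAt η (v (η t)) t)
    (h0 : Tendsto (fun j => γ j 0) atTop (𝓝 (η 0))) (t : ℝ) :
    Tendsto (fun j => γ j t) atTop (𝓝 (η t)) := by
  rw [tendsto_iff_dist_tendsto_zero] at h0 ⊢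
  refine squeeze_zero (fun _ => dist_nonneg) (fun j => dist_solution_le hv (hγ j) hη t) ?_
  simpa using h0.mul_const _

/-- A solution passing through a zero of the vector field is constant. -/
theorem solution_eq_of_eq_zero {v : E → E} {K : ℝ≥0} (hv : LipschitzWith K v) {γ : ℝ → E}
    (hγ : ∀ t, HasDerivAt γ (v (γ t)) t) {x : E} (hx : v x = 0) {t : ℝ} (ht : γ t = x) (s : ℝ) :
    γ s = x := by
  have h1 (u : ℝ) : HasDerivAt (fun u => γ (u + t)) (v (γ (u + t))) u := (hγ _).comp_add_const u t
  have := dist_solution_le hv h1 (η := fun _ => x)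
    (fun u => by simpa [hx] using hasDerivAt_const u x) (s - t)
  simpa [ht] using this

end GlobalFlow

/-- The planar field `(x, y) ↦ (y, G x y)` agrees on a rectangle with a bounded Lipschitz field. -/
theorem exists_truncated_field {G : ℝ → ℝ → ℝ} (hG : ContDiff ℝ 1 fun q : ℝ × ℝ => G q.1 q.2)
    {a M : ℝ} (ha : 0 ≤ a) (hM : 0 ≤ M) :
    ∃ (V : ℝ × ℝ → ℝ × ℝ) (K C : ℝ≥0), LipschitzWith K V ∧ (∀ q, ‖V q‖ ≤ C) ∧
      ∀ x ∈ Icc 0 a, ∀ y ∈ Icc 0 M, V (x, y) = (y, G x y) := by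
  have hR : IsCompact (Icc 0 a ×ˢ Icc 0 M) := isCompact_Icc.prod isCompact_Icc
  have hv : ContDiff ℝ 1 fun q : ℝ × ℝ => (q.2, G q.1 q.2) := contDiff_snd.prodMk hG
  obtain ⟨K, hK⟩ := hv.contDiffOn.exists_lipschitzOnWith one_ne_zero
    ((convex_Icc 0 a).prod (convex_Icc 0 M)) hR
  obtain ⟨C, hC⟩ := hR.exists_bound_of_continuousOn hv.continuous.continuousOn
  let ρ : ℝ × ℝ → ℝ × ℝ := fun q => (max 0 (min a q.1), max 0 (min M q.2))
  have hρmem (q) : ρ q ∈ Icc 0 a ×ˢ Icc 0 M :=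
    ⟨⟨le_max_left _ _, max_le ha (min_le_left _ _)⟩, ⟨le_max_left _ _, max_le hM (min_le_left _ _)⟩⟩
  have hρ : LipschitzWith 1 ρ := by
    have := ((LipschitzWith.prod_fst (α := ℝ) (β := ℝ)).const_min a |>.const_max 0).prodMk
      ((LipschitzWith.prod_snd (α := ℝ) (β := ℝ)).const_min M |>.const_max 0)
    simpa using this
  refine ⟨fun q => ((ρ q).2, G (ρ q).1 (ρ q).2), K * 1, C.toNNReal, ?_, fun q => ?_, ?_⟩
  · exact lipschitzOnWith_univ.1 (hK.comp hρ.lipschitzOnWith fun q _ => hρmem q)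
  · exact (hC _ (hρmem q)).trans (Real.le_coe_toNNReal C)
  · intro x hx y hy
    simp [ρ, hx.1, hx.2, hy.1, hy.2]

/-- A function that is nonpositive before `T` and vanishes at `T` has nonnegative derivative at
`T`. -/
theorem HasDerivAt.nonneg_of_nonpos_left {g : ℝ → ℝ} {d s T : ℝ} (hg : HasDerivAt g d T)
    (hs : s < T) (hneg : ∀ t ∈ Ioo s T, g t ≤ 0) (hT : g T = 0) : 0 ≤ d := by
  have h := (hasDerivAt_iff_tendsto_slope.1 hg).mono_left (nhdsLT_le_nhdsNE T)
  refine ge_of_tendsto h ?_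
  filter_upwards [Ioo_mem_nhdsLT hs] with t ht
  rw [slope_def_field, hT, sub_zero]
  exact div_nonneg_of_nonpos (hneg t ht) (by linarith [ht.2])

/-- A trajectory of `x' = y`, `y' = G x y` starting in the wedge `0 < x < b`, `L x < y < U x`
bounded by two strict barriers can leave it only through the side `x = b`. -/
theorem wedge_stay_or_exit {G : ℝ → ℝ → ℝ} {x y L U : ℝ → ℝ} {b M : ℝ}
    (hx : Continuous x) (hy : Continuous y) (hLc : Continuous L) (hUc : Continuous U)
    (hode : ∀ t, x t ∈ Icc 0 b → y t ∈ Icc 0 M →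
      HasDerivAt x (y t) t ∧ HasDerivAt y (G (x t) (y t)) t)
    (hL0 : ∀ u ∈ Ioc 0 b, 0 ≤ L u) (hUM : ∀ u ∈ Ioc 0 b, U u ≤ M)
    (hL : ∀ u ∈ Ioo 0 b, ∃ d, HasDerivAt L d u ∧ L u * d < G u (L u))
    (hU : ∀ u ∈ Ioo 0 b, ∃ d, HasDerivAt U d u ∧ G u (U u) < U u * d)
    (hx0 : x 0 ∈ Ioo 0 b) (hy0 : y 0 ∈ Ioo (L (x 0)) (U (x 0))) :
    (∀ t, 0 ≤ t → x t ∈ Ioo 0 b ∧ y t ∈ Ioo (L (x t)) (U (x t))) ∨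
      ∃ T, 0 < T ∧ x T = b ∧ y T ∈ Icc (L b) (U b) ∧
        ∀ t ∈ Ico 0 T, x t ∈ Ioo 0 b ∧ y t ∈ Ioo (L (x t)) (U (x t)) := by
  set W : Set ℝ := {t | x t ∈ Ioo 0 b ∧ y t ∈ Ioo (L (x t)) (U (x t))} with hW
  have hWo : IsOpen W :=
    ((isOpen_lt continuous_const hx).inter (isOpen_lt hx continuous_const)).inter
      ((isOpen_lt (hLc.comp hx) hy).inter (isOpen_lt hy (hUc.comp hx)))
  by_contra! hcon
  obtain ⟨⟨t₁, ht₁, ht₁W⟩, hexit⟩ := hcon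
  set S : Set ℝ := Ici 0 ∩ Wᶜ
  have hSc : IsClosed S := isClosed_Ici.inter hWo.isClosed_compl
  have hSne : S.Nonempty := ⟨t₁, ht₁, fun h => ht₁W h.1 h.2⟩
  have hSb : BddBelow S := ⟨0, fun t ht => ht.1⟩
  set T := sInf S
  have hTS : T ∈ S := hSc.csInf_mem hSne hSb
  have hin : ∀ t ∈ Ico 0 T, t ∈ W := fun t ht => by
    by_contra h
    exact absurd (csInf_le hSb ⟨ht.1, h⟩) (not_le.2 ht.2)
  have hTpos : 0 < T := lt_of_le_of_ne hTS.1 fun h => hTS.2 (h ▸ ⟨hx0, hy0⟩)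
  have hlim : ∀ {P : ℝ → Prop}, IsClosed {t | P t} → (∀ t ∈ W, P t) → P T := fun {P} hP h => by
    have hcl : T ∈ closure (Ico 0 T) := by
      rw [closure_Ico hTpos.ne]
      exact ⟨hTpos.le, le_rfl⟩
    exact closure_minimal (fun t ht => h t (hin t ht)) hP hcl
  have hyL : L (x T) ≤ y T := hlim (isClosed_le (hLc.comp hx) hy) fun t ht => ht.2.1.le
  have hyU : y T ≤ U (x T) := hlim (isClosed_le hy (hUc.comp hx)) fun t ht => ht.2.2.le
  have hxb : x T ≤ b := hlim (isClosed_le hx continuous_const) fun t ht => ht.1.2.le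
  have hodeW : ∀ t ∈ W, HasDerivAt x (y t) t := fun t ht =>
    (hode t ⟨ht.1.1.le, ht.1.2.le⟩ ⟨(hL0 _ ⟨ht.1.1, ht.1.2.le⟩).trans ht.2.1.le,
      ht.2.2.le.trans (hUM _ ⟨ht.1.1, ht.1.2.le⟩)⟩).1
  have hmono : MonotoneOn x (Icc 0 T) := by
    refine monotoneOn_of_deriv_nonneg (convex_Icc 0 T) hx.continuousOn ?_ ?_ <;>
      rw [interior_Icc] <;> intro t ht <;> have htW := hin t ⟨ht.1.le, ht.2⟩
    · exact (hodeW t htW).differentiableAt.differentiableWithinAt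
    · rw [(hodeW t htW).deriv]
      exact (hL0 _ ⟨htW.1.1, htW.1.2.le⟩).trans htW.2.1.le
  have hxpos : 0 < x T := hx0.1.trans_le (hmono ⟨le_rfl, hTpos.le⟩ ⟨hTpos.le, le_rfl⟩ hTpos.le)
  rcases hxb.eq_or_lt with hxb | hxb
  · obtain ⟨t, ht, htW⟩ := hexit T hTpos hxb (hxb ▸ ⟨hyL, hyU⟩)
    exact htW (hin t ht).1 (hin t ht).2
  obtain ⟨hdx, hdy⟩ := hode T ⟨hxpos.le, hxb.le⟩
    ⟨(hL0 _ ⟨hxpos, hxb.le⟩).trans hyL, hyU.trans (hUM _ ⟨hxpos, hxb.le⟩)⟩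
  rcases hyL.eq_or_lt with hyL | hyL
  · obtain ⟨d, hd, hlt⟩ := hL _ ⟨hxpos, hxb⟩
    have := ((hd.comp T hdx).sub hdy).nonneg_of_nonpos_left hTpos
      (fun t ht => by simpa using (hin t ⟨ht.1.le, ht.2⟩).2.1.le) (by simp [hyL])
    rw [hyL] at hlt
    linarith
  rcases hyU.eq_or_lt with hyU | hyU
  · obtain ⟨d, hd, hlt⟩ := hU _ ⟨hxpos, hxb⟩
    have := (hdy.sub (hd.comp T hdx)).nonneg_of_nonpos_left hTpos
      (fun t ht => by simpa using (hin t ⟨ht.1.le, ht.2⟩).2.2.le) (by simp [hyU])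
    rw [← hyU] at hlt
    linarith
  exact hTS.2 ⟨⟨hxpos, hxb⟩, hyL, hyU⟩

/-- If both barriers of the wedge issue from a zero of the field at the origin, some trajectory has
stayed in the closed wedge for all negative times. -/
theorem exists_ancient_solution_in_wedge {G : ℝ → ℝ → ℝ} {V : ℝ × ℝ → ℝ × ℝ} {K C : ℝ≥0}
    {L U : ℝ → ℝ} {b M κ Λ : ℝ} (hVl : LipschitzWith K V) (hVb : ∀ q, ‖V q‖ ≤ C)
    (hV : ∀ x ∈ Icc 0 b, ∀ y ∈ Icc 0 M, V (x, y) = (y, G x y))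
    (hV0 : V (0, 0) = 0) (hb : 0 < b) (hκ : 0 < κ) (hΛ : 0 < Λ)
    (hLc : Continuous L) (hUc : Continuous U)
    (hL0 : ∀ u ∈ Icc 0 b, κ * u ≤ L u) (hUΛ : ∀ u ∈ Icc 0 b, U u ≤ Λ * u) (hUM : Λ * b ≤ M)
    (hLU : ∀ u ∈ Ioo 0 b, L u < U u)
    (hL : ∀ u ∈ Ioo 0 b, ∃ d, HasDerivAt L d u ∧ L u * d < G u (L u))
    (hU : ∀ u ∈ Ioo 0 b, ∃ d, HasDerivAt U d u ∧ G u (U u) < U u * d) :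
    ∃ γ : ℝ → ℝ × ℝ, (∀ t, HasDerivAt γ (V (γ t)) t) ∧ (γ 0).1 = b ∧
      ∀ t ≤ 0, (γ t).1 ∈ Ioc 0 b ∧ (γ t).2 ∈ Icc (L (γ t).1) (U (γ t).1) := by
  have hUM' : ∀ u ∈ Icc 0 b, U u ≤ M := fun u hu =>
    (hUΛ u hu).trans ((mul_le_mul_of_nonneg_left hu.2 hΛ.le).trans hUM)
  have hLnn : ∀ u ∈ Icc 0 b, 0 ≤ L u := fun u hu => (mul_nonneg hκ.le hu.1).trans (hL0 u hu)
  have hfin (N : ℕ) : ∃ γ : ℝ → ℝ × ℝ, (∀ t, HasDerivAt γ (V (γ t)) t) ∧ (γ 0).1 = b ∧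
      ∀ t ∈ Icc (-(N : ℝ)) 0, (γ t).1 ∈ Icc 0 b ∧ (γ t).2 ∈ Icc (L (γ t).1) (U (γ t).1) := by
    set ε := b * Real.exp (-(Λ * (N + 1))) with hε
    have hε0 : 0 < ε := by positivity
    have hεb : ε < b := by
      rw [hε]
      refine mul_lt_of_lt_one_right hb (Real.exp_lt_one_iff.2 ?_)
      have : 0 < Λ * (N + 1) := by positivity
      linarith
    obtain ⟨y₀, hy₀⟩ := exists_between (hLU ε ⟨hε0, hεb⟩)
    obtain ⟨γ, hγ0, hγ⟩ := exists_global_solution hVl hVb (ε, y₀)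
    have hγc : Continuous γ := continuous_iff_continuousAt.2 fun t => (hγ t).continuousAt
    have hode : ∀ t, (γ t).1 ∈ Icc 0 b → (γ t).2 ∈ Icc 0 M →
        HasDerivAt (fun t => (γ t).1) (γ t).2 t ∧
          HasDerivAt (fun t => (γ t).2) (G (γ t).1 (γ t).2) t := fun t h1 h2 => by
      have h := hγ t
      rw [show V (γ t) = _ from hV _ h1 _ h2] at h
      exact ⟨h.fst, h.snd⟩
    have hWx : ∀ t, (γ t).1 ∈ Ioo 0 b ∧ (γ t).2 ∈ Ioo (L (γ t).1) (U (γ t).1) →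
        HasDerivAt (fun t => (γ t).1) (γ t).2 t := fun t ⟨h1, h2⟩ =>
      have h1' := Ioo_subset_Icc_self h1
      (hode t h1' ⟨(hLnn _ h1').trans h2.1.le, h2.2.le.trans (hUM' _ h1')⟩).1
    rcases wedge_stay_or_exit (hγc.fst) (hγc.snd) hLc hUc hode
      (fun u hu => hLnn u ⟨hu.1.le, hu.2⟩) (fun u hu => hUM' u ⟨hu.1.le, hu.2⟩) hL hU
      (by rw [hγ0]; exact ⟨hε0, hεb⟩) (by rw [hγ0]; exact hy₀) with hstay | ⟨T, hT, hxT, hyT, hin⟩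
    · exfalso
      have hxε : ∀ t, 0 ≤ t → ε ≤ (γ t).1 := fun t ht => by
        have : MonotoneOn (fun t => (γ t).1) (Ici 0) := by
          refine monotoneOn_of_deriv_nonneg (convex_Ici 0) hγc.fst.continuousOn ?_ ?_ <;>
            rw [interior_Ici] <;> intro t ht <;> have htW := hstay t ht.le
          · exact (hWx t htW).differentiableAt.differentiableWithinAt
          · rw [(hWx t htW).deriv]
            exact (hLnn _ (Ioo_subset_Icc_self htW.1)).trans htW.2.1.le
        simpa [hγ0] using this self_mem_Ici ht ht
      have hgrow := (convex_Ici (0 : ℝ)).mul_sub_le_image_sub_of_le_deriv (C := κ * ε)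
        (f := fun t => (γ t).1) hγc.fst.continuousOn
        (fun t ht => by
          rw [interior_Ici] at ht
          exact (hWx t (hstay t ht.le)).differentiableAt.differentiableWithinAt)
        (fun t ht => by
          rw [interior_Ici] at ht
          have htW := hstay t ht.le
          rw [(hWx t htW).deriv]
          exact (mul_le_mul_of_nonneg_left (hxε t ht.le) hκ.le).trans
            ((hL0 _ (Ioo_subset_Icc_self htW.1)).trans htW.2.1.le))
        0 self_mem_Ici (b / (κ * ε)) (mem_Ici.2 (by positivity)) (by positivity)
      have hlt := (hstay (b / (κ * ε)) (by positivity)).1.2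
      rw [sub_zero, mul_div_cancel₀ _ (by positivity : κ * ε ≠ 0), hγ0] at hgrow
      linarith
    · have hTN : (N : ℝ) ≤ T := by
        have hanti : AntitoneOn (fun t => (γ t).1 * Real.exp (-(Λ * t))) (Icc 0 T) := by
          have hd : ∀ t ∈ Ioo 0 T, HasDerivAt (fun t => (γ t).1 * Real.exp (-(Λ * t)))
              (((γ t).2 - Λ * (γ t).1) * Real.exp (-(Λ * t))) t := fun t ht => by
            have he : HasDerivAt (fun t : ℝ => Real.exp (-(Λ * t)))
                (Real.exp (-(Λ * t)) * -(Λ * 1)) t := ((hasDerivAt_id t).const_mul Λ).neg.exp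
            refine ((hWx t (hin t ⟨ht.1.le, ht.2⟩)).mul he).congr_deriv ?_
            ring
          refine antitoneOn_of_deriv_nonpos (convex_Icc 0 T)
            (hγc.fst.mul (by fun_prop)).continuousOn ?_ ?_ <;> rw [interior_Icc] <;> intro t ht
          · exact (hd t ht).differentiableAt.differentiableWithinAt
          · have htW := hin t ⟨ht.1.le, ht.2⟩
            rw [(hd t ht).deriv]
            refine mul_nonpos_of_nonpos_of_nonneg ?_ (Real.exp_pos _).le
            linarith [htW.2.2, hUΛ _ (Ioo_subset_Icc_self htW.1)]
        have h := hanti ⟨le_rfl, hT.le⟩ ⟨hT.le, le_rfl⟩ hT.le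
        simp only [hγ0, hxT, mul_zero, neg_zero, Real.exp_zero, mul_one, hε] at h
        have h' := Real.exp_le_exp.1 (le_of_mul_le_mul_left h hb)
        have : N + 1 ≤ T := le_of_mul_le_mul_left (neg_le_neg_iff.1 h') hΛ
        linarith
      refine ⟨fun t => γ (t + T), fun t => (hγ _).comp_add_const t T, by simpa using hxT,
        fun t ht => ?_⟩
      rcases ht.2.eq_or_lt with rfl | ht0
      · simp only [zero_add, hxT]
        exact ⟨⟨hb.le, le_rfl⟩, hyT⟩
      · have := hin (t + T) ⟨by linarith [ht.1], by linarith⟩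
        exact ⟨Ioo_subset_Icc_self this.1, Ioo_subset_Icc_self this.2⟩
  choose γ hγ hγb hγW using hfin
  have hmem (N : ℕ) : γ N 0 ∈ Icc 0 b ×ˢ Icc 0 M := by
    obtain ⟨h1, h2⟩ := hγW N 0 ⟨by simp, le_rfl⟩
    exact ⟨h1, (hLnn _ h1).trans h2.1, h2.2.trans (hUM' _ h1)⟩
  obtain ⟨q, -, θ, hθ, hlim⟩ := (isCompact_Icc.prod isCompact_Icc).tendsto_subseq hmem
  obtain ⟨η, rfl, hη⟩ := exists_global_solution hVl hVb q
  have hlimt := tendsto_solution hVl (fun j => hγ (θ j)) hη hlim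
  have h1 (t : ℝ) := ((continuous_fst.tendsto _).comp (hlimt t))
  have h2 (t : ℝ) := ((continuous_snd.tendsto _).comp (hlimt t))
  have hηb : (η 0).1 = b := tendsto_nhds_unique (h1 0) (by
    simp [Function.comp_def, hγb])
  have hev : ∀ t ≤ 0, (η t).1 ∈ Icc 0 b ∧ (η t).2 ∈ Icc (L (η t).1) (U (η t).1) := fun t ht => by
    have hW : ∀ᶠ j in atTop, (γ (θ j) t).1 ∈ Icc 0 b ∧
        (γ (θ j) t).2 ∈ Icc (L (γ (θ j) t).1) (U (γ (θ j) t).1) := by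
      filter_upwards [eventually_ge_atTop ⌈-t⌉₊] with j hj
      refine hγW (θ j) t ⟨?_, ht⟩
      have : -t ≤ (θ j : ℝ) := (Nat.le_ceil _).trans (by exact_mod_cast hj.trans (hθ.id_le j))
      linarith
    exact ⟨⟨ge_of_tendsto (h1 t) (hW.mono fun _ h => h.1.1),
        le_of_tendsto (h1 t) (hW.mono fun _ h => h.1.2)⟩,
      le_of_tendsto_of_tendsto ((hLc.tendsto _).comp (h1 t)) (h2 t) (hW.mono fun _ h => h.2.1),
      le_of_tendsto_of_tendsto (h2 t) ((hUc.tendsto _).comp (h1 t)) (hW.mono fun _ h => h.2.2)⟩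
  refine ⟨η, hη, hηb, fun t ht => ?_⟩
  obtain ⟨hx, hy⟩ := hev t ht
  refine ⟨⟨lt_of_le_of_ne hx.1 fun h0 => ?_, hx.2⟩, hy⟩
  have hy0 : (η t).2 = 0 := le_antisymm (hy.2.trans ((hUΛ _ hx).trans (by simp [← h0])))
    ((hLnn _ hx).trans hy.1)
  have := solution_eq_of_eq_zero hVl hη hV0 (Prod.ext h0.symm hy0 : η t = (0, 0)) 0
  rw [this] at hηb
  exact hb.ne hηb

/-- Connecting orbit of `x' = y`, `y' = G x y` from a saddle at the origin, with unstable eigenvalue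
`σ`, to the equilibrium `(a, 0)`. The curve `y = U x` is an upper barrier on `(0, a)`, and
`y = x (σ - D x²)` is a lower barrier near the origin. -/
theorem exists_heteroclinic {G : ℝ → ℝ → ℝ} (hG : ContDiff ℝ 1 fun q : ℝ × ℝ => G q.1 q.2)
    {a b σ D Λ : ℝ} {U : ℝ → ℝ} (hb : 0 < b) (hba : b < a) (hσ : 0 < σ) (hD : 0 < D) (hΛ : 0 < Λ)
    (hDb : D * b ^ 2 ≤ σ / 2) (hG0 : G 0 0 = 0) (hGa : G a 0 = 0)
    (hGpos : ∀ u ∈ Ioo 0 a, 0 < G u 0) (hUc : Continuous U) (hUa : U a = 0)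
    (hUΛ : ∀ u ∈ Icc 0 a, U u ≤ Λ * u)
    (hU : ∀ u ∈ Ioo 0 a, ∃ d, HasDerivAt U d u ∧ G u (U u) < U u * d)
    (hL : ∀ u ∈ Ioo 0 b,
      u * (σ - D * u ^ 2) * (σ - 3 * (D * u ^ 2)) < G u (u * (σ - D * u ^ 2)))
    (hLU : ∀ u ∈ Ioc 0 b, u * (σ - D * u ^ 2) < U u) :
    ∃ x y : ℝ → ℝ, (∀ t, HasDerivAt x (y t) t ∧ HasDerivAt y (G (x t) (y t)) t) ∧
      Tendsto (fun t => (x t, y t)) atBot (𝓝 (0, 0)) ∧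
      (∃ C > (0 : ℝ), ∃ T : ℝ, ∀ t ≤ T,
        |x t| ≤ C * Real.exp (σ * t) ∧ |y t| ≤ C * Real.exp (σ * t)) ∧
      Tendsto (fun t => (x t, y t)) atTop (𝓝 (a, 0)) ∧ StrictMono x ∧ ∀ t, 0 < y t := by
  have ha : 0 < a := hb.trans hba
  set M := Λ * a with hM
  obtain ⟨V, K, C, hVl, hVb, hV⟩ := exists_truncated_field hG ha.le (mul_pos hΛ ha).le
  have h0M : (0 : ℝ) ∈ Icc 0 M := ⟨le_rfl, (mul_pos hΛ ha).le⟩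
  have hV0 : V (0, 0) = 0 := by rw [hV 0 ⟨le_rfl, ha.le⟩ 0 h0M, hG0]; rfl
  have hVa : V (a, 0) = 0 := by rw [hV a ⟨ha.le, le_rfl⟩ 0 h0M, hGa]; rfl
  have hUM : ∀ u ∈ Icc 0 a, U u ≤ M := fun u hu =>
    (hUΛ u hu).trans (mul_le_mul_of_nonneg_left hu.2 hΛ.le)
  have hDu : ∀ u ∈ Icc 0 b, D * u ^ 2 ≤ σ / 2 := fun u hu =>
    (mul_le_mul_of_nonneg_left (pow_le_pow_left₀ hu.1 hu.2 2) hD.le).trans hDb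
  obtain ⟨γ, hγ, hγb, hγW⟩ := exists_ancient_solution_in_wedge (G := G) (b := b) (M := M)
    (L := fun u => u * (σ - D * u ^ 2)) (U := U) (κ := σ / 2) (Λ := Λ) hVl hVb
    (fun x hx y hy => hV x ⟨hx.1, hx.2.trans hba.le⟩ y hy) hV0 hb (half_pos hσ) hΛ
    (by fun_prop) hUc (fun u hu => by nlinarith [hDu u hu, hu.1])
    (fun u hu => hUΛ u ⟨hu.1, hu.2.trans hba.le⟩) (mul_le_mul_of_nonneg_left hba.le hΛ.le)
    (fun u hu => hLU u ⟨hu.1, hu.2.le⟩)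
    (fun u hu => ⟨σ - 3 * (D * u ^ 2), by
      have h := (hasDerivAt_id u).mul ((((hasDerivAt_id u).pow 2).const_mul D).const_sub σ)
      refine h.congr_deriv ?_
      simp
      ring, hL u hu⟩)
    (fun u hu => hU u ⟨hu.1, hu.2.trans hba⟩)
  have hγc : Continuous γ := continuous_iff_continuousAt.2 fun t => (hγ t).continuousAt
  set x : ℝ → ℝ := fun t => (γ t).1 with hx
  set y : ℝ → ℝ := fun t => (γ t).2 with hy
  have hode : ∀ t, x t ∈ Icc 0 a → y t ∈ Icc 0 M →
      HasDerivAt x (y t) t ∧ HasDerivAt y (G (x t) (y t)) t := fun t h1 h2 => by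
    have h := hγ t
    rw [show V (γ t) = _ from hV _ h1 _ h2] at h
    exact ⟨h.fst, h.snd⟩
  have hneg : ∀ t ≤ 0, x t ∈ Ioc 0 b ∧ x t * (σ - D * x t ^ 2) ≤ y t ∧ 0 < y t ∧ y t < U (x t) := by
    have hclosed : ∀ t ≤ 0, x t ∈ Ioo 0 a ∧ 0 < y t ∧ y t ≤ U (x t) := fun t ht => by
      obtain ⟨h1, h2, h3⟩ := hγW t ht
      exact ⟨⟨h1.1, h1.2.trans_lt hba⟩,
        (mul_pos h1.1 (by linarith [hDu _ ⟨h1.1.le, h1.2⟩])).trans_le h2, h3⟩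
    intro t ht
    obtain ⟨h1, h2, h3⟩ := hclosed t ht
    refine ⟨(hγW t ht).1, (hγW t ht).2.1, h2, lt_of_le_of_ne h3 fun heq => ?_⟩
    obtain ⟨d, hd, hlt⟩ := hU _ h1
    obtain ⟨hdx, hdy⟩ := hode t (Ioo_subset_Icc_self h1)
      ⟨h2.le, h3.trans (hUM _ (Ioo_subset_Icc_self h1))⟩
    have := (hdy.sub (hd.comp t hdx)).nonneg_of_nonpos_left (sub_one_lt t)
      (fun s hs => by simpa using (hclosed s (hs.2.le.trans ht)).2.2) (by simp [heq])
    rw [← heq] at hlt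
    linarith
  have hpos : ∀ t, 0 ≤ t → x t ∈ Ioo 0 a ∧ y t ∈ Ioo 0 (U (x t)) := by
    obtain ⟨h1, -, h2, h3⟩ := hneg 0 le_rfl
    rcases wedge_stay_or_exit (G := G) (x := x) (y := y) (L := fun _ => 0) (U := U) (b := a)
      (M := M) hγc.fst hγc.snd continuous_const hUc hode (fun _ _ => le_rfl)
      (fun u hu => hUM u (Ioc_subset_Icc_self hu))
      (fun u hu => ⟨0, hasDerivAt_const u 0, by simpa using hGpos u hu⟩) hU
      ⟨h1.1, h1.2.trans_lt hba⟩ ⟨h2, h3⟩ with h | ⟨T, -, hxT, hyT, -⟩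
    · exact h
    · rw [hUa] at hyT
      have := solution_eq_of_eq_zero hVl hγ hVa
        (Prod.ext hxT (le_antisymm hyT.2 hyT.1) : γ T = (a, 0)) 0
      rw [this] at hγb
      exact absurd hγb hba.ne'
  have hall (t : ℝ) : x t ∈ Ioo 0 a ∧ y t ∈ Ioo 0 (U (x t)) := by
    rcases le_total 0 t with ht | ht
    · exact hpos t ht
    · obtain ⟨h1, -, h2, h3⟩ := hneg t ht
      exact ⟨⟨h1.1, h1.2.trans_lt hba⟩, h2, h3⟩
  have hyM (t : ℝ) : y t ∈ Icc 0 M :=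
    ⟨(hall t).2.1.le, (hall t).2.2.le.trans (hUM _ (Ioo_subset_Icc_self (hall t).1))⟩
  have hsol (t : ℝ) := hode t (Ioo_subset_Icc_self (hall t).1) (hyM t)
  have hmono : StrictMono x := strictMono_of_deriv_pos fun t => by
    rw [(hsol t).1.deriv]
    exact (hall t).2.1
  have hyx (t : ℝ) : y t ≤ Λ * x t :=
    (hall t).2.2.le.trans (hUΛ _ (Ioo_subset_Icc_self (hall t).1))
  have hdecay : ∃ C₀ > (0 : ℝ), ∀ t ≤ 0, x t ≤ C₀ * Real.exp (σ * t) := by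
    set h : ℝ → ℝ := fun t => x t * Real.exp (D * x t ^ 2 / σ - σ * t) with hh
    have hd (t : ℝ) : HasDerivAt h
        ((y t * (1 + 2 * (D * x t ^ 2) / σ) - σ * x t) * Real.exp (D * x t ^ 2 / σ - σ * t)) t := by
      have he := ((((hsol t).1.pow 2).const_mul D).div_const σ).sub
        ((hasDerivAt_id t).const_mul σ) |>.exp
      refine ((hsol t).1.mul he).congr_deriv ?_
      simp
      ring
    have hmon : MonotoneOn h (Iic 0) := by
      refine monotoneOn_of_deriv_nonneg (convex_Iic 0)
        (fun t _ => (hd t).continuousAt.continuousWithinAt)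
        (fun t _ => (hd t).differentiableAt.differentiableWithinAt) fun t ht => ?_
      rw [interior_Iic] at ht
      obtain ⟨h1, h2, h3, -⟩ := hneg t ht.le
      rw [(hd t).deriv]
      refine mul_nonneg ?_ (Real.exp_pos _).le
      have he := hDu _ (Ioc_subset_Icc_self h1)
      have he0 : 0 ≤ D * x t ^ 2 := by positivity
      set e := D * x t ^ 2
      have h4 : x t * (σ - e) * (1 + 2 * e / σ) ≤ y t * (1 + 2 * e / σ) :=
        mul_le_mul_of_nonneg_right h2 (by positivity)
      have h5 : x t * (σ - e) * (1 + 2 * e / σ) - σ * x t = x t * (e * (σ - 2 * e)) / σ := by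
        field_simp
        ring
      have h6 : 0 ≤ x t * (e * (σ - 2 * e)) / σ :=
        div_nonneg (mul_nonneg h1.1.le (mul_nonneg he0 (by linarith))) hσ.le
      linarith
    refine ⟨h 0, mul_pos (hall 0).1.1 (Real.exp_pos _), fun t ht => ?_⟩
    have h1 := hmon ht self_mem_Iic ht
    have h2 : x t * Real.exp (-(σ * t)) ≤ h t :=
      mul_le_mul_of_nonneg_left (Real.exp_le_exp.2 (by
        have : 0 ≤ D * x t ^ 2 / σ := by positivity
        linarith)) (hall t).1.1.le
    calc x t = x t * Real.exp (-(σ * t)) * Real.exp (σ * t) := by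
          rw [mul_assoc, ← Real.exp_add]; simp
      _ ≤ h 0 * Real.exp (σ * t) := mul_le_mul_of_nonneg_right (h2.trans h1) (Real.exp_pos _).le
  obtain ⟨C₀, hC₀, hxC⟩ := hdecay
  have hexp : Tendsto (fun t => Real.exp (σ * t)) atBot (𝓝 0) :=
    Real.tendsto_exp_atBot.comp (tendsto_id.const_mul_atBot hσ)
  have hxbot : Tendsto x atBot (𝓝 0) :=
    squeeze_zero' (Eventually.of_forall fun t => (hall t).1.1.le)
      ((eventually_le_atBot 0).mono hxC) (by simpa using hexp.const_mul C₀)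
  have hybot : Tendsto y atBot (𝓝 0) :=
    squeeze_zero (fun t => (hall t).2.1.le) hyx (by simpa using hxbot.const_mul Λ)
  have hxtop : Tendsto x atTop (𝓝 a) := by
    have hbdd : BddAbove (range x) := ⟨a, by rintro _ ⟨t, rfl⟩; exact (hall t).1.2.le⟩
    have hlim := tendsto_atTop_ciSup hmono.monotone hbdd
    set l := ⨆ t, x t
    have hxl (t : ℝ) : x t ≤ l := le_ciSup hbdd t
    rcases (le_of_tendsto' hlim fun t => (hall t).1.2.le : l ≤ a).eq_or_lt with hla | hla
    · rwa [hla] at hlim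
    exfalso
    have hGc : Continuous fun u => G u 0 :=
      hG.continuous.comp (by fun_prop : Continuous fun u : ℝ => (u, (0 : ℝ)))
    obtain ⟨u₀, hu₀, hmin⟩ := isCompact_Icc.exists_isMinOn
      (nonempty_Icc.2 (hxl 0)) hGc.continuousOn
    set c := G u₀ 0
    have hc : 0 < c := hGpos _ ⟨(hall 0).1.1.trans_le hu₀.1, hu₀.2.trans_lt hla⟩
    have hlip (t : ℝ) (ht : 0 ≤ t) : c ≤ G (x t) (y t) + K * y t := by
      have h1 : c ≤ G (x t) 0 := hmin ⟨hmono.monotone ht, hxl t⟩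
      have h2 := hVl.dist_le_mul (x t, y t) (x t, 0)
      rw [hV _ (Ioo_subset_Icc_self (hall t).1) _ (hyM t),
        hV _ (Ioo_subset_Icc_self (hall t).1) _ h0M, Prod.dist_eq, Prod.dist_eq] at h2
      have h3 := (le_max_right _ _).trans h2
      simp only [dist_self, Real.dist_eq, sub_zero, abs_of_pos (hall t).2.1,
        max_eq_right (hall t).2.1.le] at h3
      linarith [(abs_le.1 h3).1]
    have hd (t : ℝ) : HasDerivAt (fun t => y t + K * x t) (G (x t) (y t) + K * y t) t :=
      (hsol t).2.add ((hsol t).1.const_mul (K : ℝ))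
    have hgrow := (convex_Ici (0 : ℝ)).mul_sub_le_image_sub_of_le_deriv (C := c)
      (f := fun t => y t + K * x t) (fun t _ => (hd t).continuousAt.continuousWithinAt)
      (fun t _ => (hd t).differentiableAt.differentiableWithinAt)
      (fun t ht => by
        rw [interior_Ici] at ht
        rw [(hd t).deriv]
        exact hlip t ht.le)
      0 self_mem_Ici ((M + K * a) / c) (mem_Ici.2 (by positivity)) (by positivity)
    rw [sub_zero, mul_div_cancel₀ _ hc.ne'] at hgrow
    have h1 := (hyM ((M + K * a) / c)).2
    have h2 := mul_le_mul_of_nonneg_left (hall ((M + K * a) / c)).1.2.le K.coe_nonneg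
    have h3 := (hall 0).2.1
    have h4 := mul_nonneg K.coe_nonneg (hall 0).1.1.le
    linarith
  have hytop : Tendsto y atTop (𝓝 0) :=
    squeeze_zero (fun t => (hall t).2.1.le) (fun t => (hall t).2.2.le)
      (by simpa [hUa, Function.comp_def] using (hUc.tendsto a).comp hxtop)
  refine ⟨x, y, hsol, hxbot.prodMk_nhds hybot, ⟨C₀ * (1 + Λ), by positivity, 0, fun t ht => ?_⟩,
    hxtop.prodMk_nhds hytop, hmono, fun t => (hall t).2.1⟩
  rw [abs_of_pos (hall t).1.1, abs_of_pos (hall t).2.1]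
  have h1 := hxC t ht
  have h2 := hyx t
  have h3 := mul_le_mul_of_nonneg_left h1 hΛ.le
  have h4 : 0 < C₀ * Real.exp (σ * t) := by positivity
  constructor <;> nlinarith

/-- Polynomial whose positivity says that the curve `ψ = 3/2 * φ * (K / w - 1)` is an upper
barrier, in terms of `w = (n - p) * lam ^ 2 * φ ^ 2 + n`. -/
noncomputable def barrierPoly (n p K w : ℝ) : ℝ :=
  -6 * K * w ^ 2 * (w - p) + 4 * K * (n - p) * w ^ 3 + p * w * (w - n) * (3 * K - w) ^ 2 -
    18 * K ^ 2 * w * (w - p) + 36 * K ^ 2 * n * (w - p)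

theorem barrierPoly_pos_of_seven_le {n p K w : ℝ} (hn : 7 ≤ n) (hpn : p < n) (hnp : n < 2 * p)
    (hw : n < w) (hK : w < K) : 0 < barrierPoly n p K w := by
  obtain ⟨a, rfl⟩ : ∃ a, n = 7 + a := ⟨n - 7, by ring⟩
  obtain ⟨y, rfl⟩ : ∃ y, w = 7 + a + y := ⟨w - (7 + a), by ring⟩
  obtain ⟨z, rfl⟩ : ∃ z, K = 7 + a + y + z := ⟨K - (7 + a + y), by ring⟩
  have ha : 0 ≤ a := by linarith
  have hy : 0 < y := by linarith
  have hz : 0 < z := by linarith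
  have h_full : 0 ≤ barrierPoly (7 + a) (7 + a) (7 + a + y + z) (7 + a + y) := by
    unfold barrierPoly
    ring_nf
    positivity
  have h_half : 0 < 2 * barrierPoly (7 + a) ((7 + a) / 2) (7 + a + y + z) (7 + a + y) := by
    unfold barrierPoly
    ring_nf
    positivity
  have h_lin : (7 + a) * barrierPoly (7 + a) p (7 + a + y + z) (7 + a + y) =
      (2 * p - (7 + a)) * barrierPoly (7 + a) (7 + a) (7 + a + y + z) (7 + a + y) +
      (7 + a - p) * (2 * barrierPoly (7 + a) ((7 + a) / 2) (7 + a + y + z) (7 + a + y)) := by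
    unfold barrierPoly
    ring
  have h1 := mul_nonneg (sub_pos.2 hnp).le h_full
  have h2 := mul_pos (sub_pos.2 hpn) h_half
  exact pos_of_mul_pos_right (by linarith : 0 < (7 + a) * _) (by linarith)

theorem barrierPoly_pos_three_two {w : ℝ} (h0 : 3 < w) (h1 : w < 8) : 0 < barrierPoly 3 2 8 w := by
  obtain ⟨x, hx⟩ : ∃ x, x = w - 3 := ⟨_, rfl⟩
  obtain ⟨y, hy⟩ : ∃ y, y = 8 - w := ⟨_, rfl⟩
  have hx0 : 0 < x := by linarith
  have hy0 : 0 < y := by linarith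
  have : 625 * barrierPoly 3 2 8 w = 4608 * x ^ 4 + 51712 * x ^ 3 * y + 85488 * x ^ 2 * y ^ 2 +
      41022 * x * y ^ 3 + 3888 * y ^ 4 := by
    subst hx hy; unfold barrierPoly; ring
  have : 0 < 625 * barrierPoly 3 2 8 w := by rw [this]; positivity
  linarith

theorem barrierPoly_pos_five_four_of_twelve {w : ℝ} (h0 : 5 < w) (h1 : w < 12) :
    0 < barrierPoly 5 4 12 w := by
  obtain ⟨x, hx⟩ : ∃ x, x = w - 5 := ⟨_, rfl⟩
  obtain ⟨y, hy⟩ : ∃ y, y = 12 - w := ⟨_, rfl⟩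
  have hx0 : 0 < x := by linarith
  have hy0 : 0 < y := by linarith
  have : 2401 * barrierPoly 5 4 12 w = 152064 * x ^ 4 + 620352 * x ^ 3 * y +
      744048 * x ^ 2 * y ^ 2 + 283316 * x * y ^ 3 + 17160 * y ^ 4 := by
    subst hx hy; unfold barrierPoly; ring
  have : 0 < 2401 * barrierPoly 5 4 12 w := by rw [this]; positivity
  linarith

theorem barrierPoly_pos_five_four_of_thirty_two {w : ℝ} (h0 : 5 < w) (h1 : w < 32) :
    0 < barrierPoly 5 4 32 w := by
  obtain ⟨x, hx⟩ : ∃ x, x = w - 5 := ⟨_, rfl⟩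
  obtain ⟨y, hy⟩ : ∃ y, y = 32 - w := ⟨_, rfl⟩
  have hx0 : 0 < x := by linarith
  have hy0 : 0 < y := by linarith
  have : 531441 * barrierPoly 5 4 32 w = 1490944 * x ^ 4 + 20672512 * x ^ 3 * y +
      28157568 * x ^ 2 * y ^ 2 + 6953596 * x * y ^ 3 + 103360 * y ^ 4 := by
    subst hx hy; unfold barrierPoly; ring
  have : 0 < 531441 * barrierPoly 5 4 32 w := by rw [this]; positivity
  linarith

theorem contDiff_X2 (n p : ℕ) (lam : ℝ) :
    ContDiff ℝ 1 fun q : ℝ × ℝ => X2 n p lam q.1 q.2 := by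
  have h : ∀ q : ℝ × ℝ, 1 + lam ^ 2 * q.1 ^ 2 ≠ 0 := fun q => by positivity
  unfold X2 f1 f2
  fun_prop (disch := exact h)

theorem f1_pos_iff {n p : ℕ} {lam K φ : ℝ} (hK : lam ^ 2 * p = K) :
    0 < f1 n p lam φ ↔ (n - p) * lam ^ 2 * φ ^ 2 + n < K := by
  have h : 0 < 1 + lam ^ 2 * φ ^ 2 := by positivity
  rw [f1, sub_pos, lt_div_iff₀ h, ← sub_pos, ← hK, ← sub_pos (b := _ + _)]
  ring_nf

theorem f1_eq_zero {n p : ℕ} {lam K φ : ℝ} (hK : lam ^ 2 * p = K)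
    (hφ : ((n : ℝ) - p) * lam ^ 2 * φ ^ 2 = K - n) : f1 n p lam φ = 0 := by
  have h : 1 + lam ^ 2 * φ ^ 2 ≠ 0 := by positivity
  rw [f1, sub_eq_zero, div_eq_iff h]
  linear_combination hK - hφ

theorem hasDerivAt_upperBarrier {c n K u : ℝ} (h : c * u ^ 2 + n ≠ 0) :
    HasDerivAt (fun u => 3 / 2 * u * (K / (c * u ^ 2 + n) - 1))
      (3 / 2 * (-1 - K / (c * u ^ 2 + n) + 2 * K * n / (c * u ^ 2 + n) ^ 2)) u := by
  have h1 : HasDerivAt (fun u : ℝ => c * u ^ 2 + n) (c * (2 * u)) u := by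
    simpa using ((hasDerivAt_pow 2 u).const_mul c).add_const n
  have h2 := (((hasDerivAt_id u).const_mul (3 / 2)).mul
    (((hasDerivAt_const u K).div h1 h).sub_const 1))
  refine h2.congr_deriv ?_
  simp only [Pi.div_apply, id]
  field_simp
  ring

theorem X2_lt_upperBarrier {n p : ℕ} {lam K u : ℝ} (hp : (0 : ℝ) < p) (hpn : (p : ℝ) < n)
    (hK : lam ^ 2 * p = K) {w : ℝ} (hw : w = (n - p) * lam ^ 2 * u ^ 2 + n) (hu : 0 < u)
    (hwK : w < K) (hnw : n < w) (hP : 0 < barrierPoly n p K w) :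
    X2 n p lam u (3 / 2 * u * (K / w - 1)) <
      3 / 2 * u * (K / w - 1) * (3 / 2 * (-1 - K / w + 2 * K * n / w ^ 2)) := by
  have hm : 0 < (n : ℝ) - p := sub_pos.2 hpn
  have hwp : 0 < w - p := by linarith
  have hw0 : 0 < w := by linarith
  have hK0 : 0 < K := by linarith
  have hs : 1 + lam ^ 2 * u ^ 2 = (w - p) / (n - p) := by
    rw [eq_div_iff hm.ne', hw]; ring
  have hu2 : u ^ 2 = p * (w - n) / ((n - p) * K) := by
    rw [eq_div_iff (by positivity), hw, ← hK]; ring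
  have hf1 : f1 n p lam u = (n - p) * (K - w) / (w - p) := by
    rw [f1, hs, sub_mul, hK]; field_simp; ring
  have hf2 : f2 n p lam u = (n - p) * w / (w - p) := by
    rw [f2, hs]; field_simp; ring
  have hsq : (u + 3 / 2 * u * (K / w - 1)) ^ 2 =
      p * (w - n) / ((n - p) * K) * ((3 * K - w) / (2 * w)) ^ 2 := by
    rw [← hu2]; field_simp; ring
  have key : 3 / 2 * u * (K / w - 1) * (3 / 2 * (-1 - K / w + 2 * K * n / w ^ 2)) -
      X2 n p lam u (3 / 2 * u * (K / w - 1)) =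
      u * (K - w) * barrierPoly n p K w / (8 * K * w ^ 3 * (w - p)) := by
    rw [X2, hsq, hf1, hf2, barrierPoly]
    field_simp
    ring
  have : 0 < u * (K - w) * barrierPoly n p K w / (8 * K * w ^ 3 * (w - p)) := by
    have := sub_pos.2 hwK
    positivity
  linarith

theorem lowerBarrier_lt_X2 {n p : ℕ} {lam K σ u : ℝ} (hp : (0 : ℝ) < p) (hpn : (p : ℝ) < n)
    (hK : lam ^ 2 * p = K) (hσ : 0 < σ) (hKσ : K = (n + σ) * (1 + σ)) (hu : 0 < u)
    (hu2 : (K - p) * lam ^ 2 * u ^ 2 ≤ σ / 2) :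
    u * (σ - (K - p) * lam ^ 2 * u ^ 2) * (σ - 3 * ((K - p) * lam ^ 2 * u ^ 2)) <
      X2 n p lam u (u * (σ - (K - p) * lam ^ 2 * u ^ 2)) := by
  have hKn : (n : ℝ) < K := by rw [hKσ]; nlinarith
  have hlam : 0 < lam ^ 2 := by
    by_contra! h
    nlinarith
  set e := (K - p) * lam ^ 2 * u ^ 2 with he
  have he0 : 0 < e := mul_pos (mul_pos (by linarith) hlam) (pow_pos hu 2)
  have hs : 0 < 1 + lam ^ 2 * u ^ 2 := by positivity
  have hf1 : K - n - e ≤ f1 n p lam u := by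
    have : K - p - e ≤ (K - p) / (1 + lam ^ 2 * u ^ 2) := by
      rw [le_div_iff₀ hs, he]
      have : 0 ≤ (K - p) * (lam ^ 2 * u ^ 2) ^ 2 :=
        mul_nonneg (by linarith) (by positivity)
      linarith
    rw [f1, sub_mul, hK, one_mul]
    linarith
  have hf2 : f2 n p lam u ≤ n := by
    have : (p : ℝ) / (1 + lam ^ 2 * u ^ 2) ≤ p :=
      div_le_self hp.le (by linarith [show 0 ≤ lam ^ 2 * u ^ 2 by positivity])
    rw [f2]; linarith
  have hq : σ ^ 2 + σ + (n - 1) * e ≤ f1 n p lam u - f2 n p lam u * (σ - e) := by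
    have := mul_le_mul_of_nonneg_right hf2 (by linarith : 0 ≤ σ - e)
    rw [hKσ] at hf1
    linarith
  have hn : (0 : ℝ) < n := hp.trans hpn
  have hn1 : (1 : ℝ) ≤ n := by
    exact_mod_cast Nat.one_le_iff_ne_zero.2 (by rintro rfl; simp at hn)
  have hq0 : 0 ≤ f1 n p lam u - f2 n p lam u * (σ - e) :=
    le_trans (by have := mul_nonneg (sub_nonneg.2 hn1) he0.le; positivity) hq
  have h1 : (σ - e) * (σ - 3 * e) <
      -(σ - e) + (f1 n p lam u - f2 n p lam u * (σ - e)) := by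
    nlinarith [mul_pos hn he0, mul_pos hσ he0]
  have h2 := mul_nonneg hq0 (sq_nonneg (u + u * (σ - e)))
  have h3 := mul_lt_mul_of_pos_left h1 hu
  have h4 := mul_nonneg hu.le h2
  rw [X2]
  linarith

theorem exists_heteroclinic_X2 {n p : ℕ} {lam K σ a : ℝ} (hp : (0 : ℝ) < p) (hpn : (p : ℝ) < n)
    (hK : lam ^ 2 * p = K) (hσ : 0 < σ) (hKσ : K = (n + σ) * (1 + σ)) (ha : 0 < a)
    (ha2 : ((n : ℝ) - p) * lam ^ 2 * a ^ 2 = K - n)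
    (hP : ∀ w : ℝ, n < w → w < K → 0 < barrierPoly n p K w) :
    ∃ φ ψ : ℝ → ℝ, (∀ t, HasDerivAt φ (ψ t) t ∧ HasDerivAt ψ (X2 n p lam (φ t) (ψ t)) t) ∧
      Tendsto (fun t => (φ t, ψ t)) atBot (𝓝 (0, 0)) ∧
      (∃ C > (0 : ℝ), ∃ T : ℝ, ∀ t ≤ T,
        |φ t| ≤ C * Real.exp (σ * t) ∧ |ψ t| ≤ C * Real.exp (σ * t)) ∧
      Tendsto (fun t => (φ t, ψ t)) atTop (𝓝 (a, 0)) ∧ StrictMono φ ∧ ∀ t, 0 < ψ t := by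
  have hm : 0 < (n : ℝ) - p := sub_pos.2 hpn
  have hn : (0 : ℝ) < n := hp.trans hpn
  have hKn : (n : ℝ) + σ < K := by rw [hKσ]; nlinarith [mul_pos hn hσ]
  have hK0 : 0 < K := by linarith
  have hlam : 0 < lam ^ 2 := by
    by_contra! h
    nlinarith
  set D := (K - p) * lam ^ 2 with hD
  have hD0 : 0 < D := mul_pos (by linarith) hlam
  have hcD : (n - p) * lam ^ 2 < D := mul_lt_mul_of_pos_right (by linarith) hlam
  have hc : 0 < (n - p) * lam ^ 2 := mul_pos hm hlam
  have hb2 : D * √(σ / (2 * D)) ^ 2 = σ / 2 := by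
    rw [Real.sq_sqrt (by positivity)]; field_simp
  have hb0 : 0 < √(σ / (2 * D)) := by positivity
  have hw : ∀ u, 0 < (n - p) * lam ^ 2 * u ^ 2 + n := fun u => by positivity
  have hwK : ∀ u ∈ Ioo 0 a, (n - p) * lam ^ 2 * u ^ 2 + n < K := fun u hu => by
    have := mul_lt_mul_of_pos_left (pow_lt_pow_left₀ hu.2 hu.1.le two_ne_zero) hc
    linarith
  refine exists_heteroclinic (contDiff_X2 n p lam) (b := √(σ / (2 * D))) (D := D)
    (U := fun u => 3 / 2 * u * (K / ((n - p) * lam ^ 2 * u ^ 2 + n) - 1)) (Λ := 3 / 2 * (K / n))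
    hb0 ?_ hσ hD0 (by positivity) hb2.le (by simp [X2]) (by simp [X2, f1_eq_zero hK ha2])
    (fun u hu => ?_) ?_ ?_ (fun u hu => ?_) (fun u hu => ?_) (fun u hu => ?_) (fun u hu => ?_)
  · refine lt_of_pow_lt_pow_left₀ 2 ha.le (lt_of_mul_lt_mul_left ?_ hc.le)
    have := mul_lt_mul_of_pos_right hcD (pow_pos hb0 2)
    linarith
  · have := mul_pos (mul_pos ((f1_pos_iff hK).2 (hwK u hu)) hu.1)
      (by positivity : 0 < 1 + (u + 0) ^ 2)
    rw [X2]
    linarith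
  · exact (continuous_const.mul continuous_id).mul
      ((continuous_const.div (by fun_prop) fun u => (hw u).ne').sub continuous_const)
  · simp only [ha2, sub_add_cancel, div_self hK0.ne', sub_self, mul_zero]
  · have : K / ((n - p) * lam ^ 2 * u ^ 2 + n) ≤ K / n :=
      div_le_div_of_nonneg_left hK0.le hn (le_add_of_nonneg_left (by positivity))
    have := mul_le_mul_of_nonneg_left (sub_le_sub_right this 1) hu.1
    have := hu.1
    linarith
  · have := mul_pos hc (pow_pos hu.1 2)
    exact ⟨_, hasDerivAt_upperBarrier (hw u).ne', X2_lt_upperBarrier hp hpn hK rfl hu.1 (hwK u hu)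
      (by linarith) (hP _ (by linarith) (hwK u hu))⟩
  · refine lowerBarrier_lt_X2 hp hpn hK hσ hKσ hu.1 ?_
    have := mul_le_mul_of_nonneg_left (pow_le_pow_left₀ hu.1.le hu.2.le 2) hD0.le
    linarith
  · have h1 := mul_le_mul_of_nonneg_left (pow_le_pow_left₀ hu.1.le hu.2 2) hD0.le
    have h2 := mul_le_mul_of_nonneg_right hcD.le (sq_nonneg u)
    have h3 : 1 + σ ≤ K / ((n - p) * lam ^ 2 * u ^ 2 + n) := by
      rw [le_div_iff₀ (hw u), hKσ, mul_comm (n + σ)]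
      exact mul_le_mul_of_nonneg_left (by linarith) (by positivity)
    have h4 := mul_le_mul_of_nonneg_left h3 hu.1.le
    have h5 := mul_pos hu.1 (mul_pos hD0 (pow_pos hu.1 2))
    have h6 := mul_pos hu.1 hσ
    linarith

theorem barrierPoly_pos_of_type_I {n p k : ℕ}
    (h : (n, p, k) = (3, 2, 2) ∨ (n, p, k) = (5, 4, 2) ∨ (n, p, k) = (5, 4, 4) ∨
      (7 ≤ n ∧ p < n ∧ n < 2 * p ∧ 4 ≤ p ∧ 2 ≤ k)) {w : ℝ} (hnw : n < w)
    (hwK : w < k * ((k : ℝ) + n - 1)) :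
    0 < barrierPoly n p (k * ((k : ℝ) + n - 1)) w := by
  simp only [Prod.mk.injEq] at h
  obtain ⟨rfl, rfl, rfl⟩ | ⟨rfl, rfl, rfl⟩ | ⟨rfl, rfl, rfl⟩ | ⟨hn, hpn, hnp, -, -⟩ := h
  · norm_num at hnw hwK ⊢
    exact barrierPoly_pos_three_two hnw hwK
  · norm_num at hnw hwK ⊢
    exact barrierPoly_pos_five_four_of_twelve hnw hwK
  · norm_num at hnw hwK ⊢
    exact barrierPoly_pos_five_four_of_thirty_two hnw hwK
  · exact barrierPoly_pos_of_seven_le (mod_cast hn) (mod_cast hpn) (mod_cast hnp) hnw hwK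

end Heteroclinic

/-- Proposition 3.4 of Xu–Yang–Zhang (Type (I) cases): existence of a global
solution of (ODE2) connecting the saddle `(0,0)` to the stable center `(φ₀,0)`,
with exponential decay `O(e^{(k-1)t})` at `-∞`, strictly increasing `φ` and
positive `ψ`. -/
theorem ode2_heteroclinic_type_I (n p k : ℕ)
    (h : (n, p, k) = (3, 2, 2) ∨ (n, p, k) = (5, 4, 2) ∨ (n, p, k) = (5, 4, 4) ∨
      (7 ≤ n ∧ p < n ∧ n < 2 * p ∧ 4 ≤ p ∧ 2 ≤ k))
    (lam φ₀ : ℝ)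
    (hlam : lam = Real.sqrt ((k : ℝ) * ((k : ℝ) + n - 1) / p))
    (hφ₀ : φ₀ = Real.sqrt (((p : ℝ) - n / lam ^ 2) / ((n : ℝ) - p))) :
    ∃ φ ψ : ℝ → ℝ,
      (∀ t : ℝ, HasDerivAt φ (ψ t) t ∧
        HasDerivAt ψ (X2 n p lam (φ t) (ψ t)) t) ∧
      Filter.Tendsto (fun t => (φ t, ψ t)) Filter.atBot (nhds (0, 0)) ∧
      (∃ C > (0 : ℝ), ∃ T : ℝ, ∀ t ≤ T,
        |φ t| ≤ C * Real.exp (((k : ℝ) - 1) * t) ∧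
        |ψ t| ≤ C * Real.exp (((k : ℝ) - 1) * t)) ∧
      Filter.Tendsto (fun t => (φ t, ψ t)) Filter.atTop (nhds (φ₀, 0)) ∧
      StrictMono φ ∧
      (∀ t : ℝ, 0 < ψ t) := by
  have hnat : 0 < p ∧ p < n ∧ 2 ≤ k := by
    simp only [Prod.mk.injEq] at h
    lia
  have hp : (0 : ℝ) < p := mod_cast hnat.1
  have hpn : (p : ℝ) < n := mod_cast hnat.2.1
  have hk : (2 : ℝ) ≤ k := mod_cast hnat.2.2
  have hKn : (n : ℝ) < k * ((k : ℝ) + n - 1) := by nlinarith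
  have hK0 : 0 < k * ((k : ℝ) + n - 1) := by linarith
  have hlam2 : lam ^ 2 = k * ((k : ℝ) + n - 1) / p := by
    rw [hlam, Real.sq_sqrt (by positivity)]
  have hφ_pos : 0 < ((p : ℝ) - n / lam ^ 2) / ((n : ℝ) - p) := by
    refine div_pos (sub_pos.2 ?_) (sub_pos.2 hpn)
    rw [hlam2, div_div_eq_mul_div, div_lt_iff₀ hK0, mul_comm]
    gcongr
  refine exists_heteroclinic_X2 hp hpn (K := k * ((k : ℝ) + n - 1)) ?_ (by linarith) (by ring)
    (hφ₀ ▸ Real.sqrt_pos.2 hφ_pos) ?_ fun w => barrierPoly_pos_of_type_I h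
  · rw [hlam2, div_mul_cancel₀ _ hp.ne']
  · rw [hφ₀, Real.sq_sqrt hφ_pos.le, hlam2]
    have := (sub_pos.2 hpn).ne'
    have : (k : ℝ) + n - 1 ≠ 0 := right_ne_zero_of_mul hK0.ne'
    field_simp
end

section
/- Suppose (n, p) = (3, 2) and k ≥ 4 is an integer, or (n, p) = (5, 4) and k ≥ 6 is an integer. Let λ = √(k(k+n−1)/p) and φ₀ = √((p − n/λ²)/(n−p)). Then there exist a continuously differentiable solution t ∈ ℝ ↦ (φ(t), ψ(t)) of (ODE2) defined on all of ℝ and a strictly increasing sequence (T_i)_{i≥1} of real numbers such that: (φ(t), ψ(t)) → (0, 0) as t → −∞; there exist C > 0 and T ∈ ℝ with |φ(t)| ≤ C·e^{(k−1)t} and |ψ(t)| ≤ C·e^{(k−1)t} for all t ≤ T; (φ(t), ψ(t)) → (φ₀, 0) as t → +∞; T_i → +∞; ψ(T_i) = 0 for every i; writing φ_i = φ(T_i), the sequence (φ_{2m−1})_{m≥1} is strictly decreasing and (φ_{2m})_{m≥1} is strictly increasing, and both converge to φ₀; ψ(t) > 0 for t ∈ (−∞, T₁) and for t in each interval (T_{2m},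 T_{2m+1}); ψ(t) < 0 for t in each interval (T_{2m−1}, T_{2m}); and φ(t) + ψ(t) > 0 for all t ∈ ℝ. -/
section

open Set Filter Topology

/-- A bounded Lipschitz vector field has integral curves defined for all times. -/
lemma exists_integral_curve_of_lipschitz_of_bounded {E : Type*} [NormedAddCommGroup E]
    [NormedSpace ℝ E] [CompleteSpace E] {f : E → E} {K C : NNReal} (hf : LipschitzWith K f)
    (hC : ∀ x, ‖f x‖ ≤ C) (x : E) :
    ∃ γ : ℝ → E, γ 0 = x ∧ ∀ t, HasDerivAt γ (f (γ t)) t := by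
  have hloc (N : ℕ) : ∃ γ : ℝ → E, γ 0 = x ∧
      ∀ t ∈ Ioo (-(N : ℝ)) N, HasDerivAt γ (f (γ t)) t := by
    have hN : (0 : ℝ) ∈ Icc (-(N : ℝ)) N := ⟨by simp, by simp⟩
    have hPL : IsPicardLindelof (fun _ ↦ f) (⟨0, hN⟩ : Icc (-(N : ℝ)) N) x (C * N) 0 C K :=
      { lipschitzOnWith := fun _ _ ↦ hf.lipschitzOnWith
        continuousOn := fun _ _ ↦ continuousOn_const
        norm_le := fun _ _ y _ ↦ hC y
        mul_max_le := by simp }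
    obtain ⟨γ, h0, hγ⟩ := hPL.exists_eq_forall_mem_Icc_hasDerivWithinAt₀
    exact ⟨γ, h0, fun t ht ↦
      (hγ t (Ioo_subset_Icc_self ht)).hasDerivAt (Icc_mem_nhds ht.1 ht.2)⟩
  choose γ h0 hγ using hloc
  have hagree {M N : ℕ} (hM : 0 < M) (hMN : M ≤ N) {t : ℝ} (ht : t ∈ Ioo (-(M : ℝ)) M) :
      γ M t = γ N t := by
    have hMN' : (M : ℝ) ≤ N := by exact_mod_cast hMN
    have hM' : (0 : ℝ) < M := by exact_mod_cast hM
    exact ODE_solution_unique_of_mem_Ioo (v := fun _ ↦ f) (s := fun _ ↦ univ) (t₀ := 0)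
      (fun _ _ ↦ hf.lipschitzOnWith) ⟨by linarith, hM'⟩
      (fun s hs ↦ ⟨hγ M s hs, trivial⟩)
      (fun s hs ↦ ⟨hγ N s ⟨by linarith [hs.1], by linarith [hs.2]⟩, trivial⟩)
      (by rw [h0, h0]) ht
  have habs (t : ℝ) : |t| < ((⌈|t|⌉₊ + 1 : ℕ) : ℝ) := by
    push_cast
    linarith [Nat.le_ceil |t|]
  have hself (t : ℝ) (N : ℕ) (hN : |t| < N) : γ (⌈|t|⌉₊ + 1) t = γ N t := by
    have hNpos : 0 < N := by exact_mod_cast (abs_nonneg t).trans_lt hN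
    rcases le_total (⌈|t|⌉₊ + 1) N with hle | hle
    · exact hagree (Nat.succ_pos _) hle (abs_lt.1 (habs t))
    · exact (hagree hNpos hle (abs_lt.1 hN)).symm
  refine ⟨fun t ↦ γ (⌈|t|⌉₊ + 1) t, h0 _, fun t ↦ ?_⟩
  refine (hγ _ t (abs_lt.1 (habs t))).congr_of_eventuallyEq ?_
  filter_upwards [continuous_abs.continuousAt.eventually_lt continuousAt_const (habs t)]
    with s hs using hself s _ hs

/-- Backward continuous dependence on the initial value for a Lipschitz autonomous field. -/
lemma dist_integral_curves_le {E : Type*} [NormedAddCommGroup E] [NormedSpace ℝ E]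
    {f : E → E} {K : NNReal} (hf : LipschitzWith K f) {γ η : ℝ → E}
    (hγ : ∀ t, HasDerivAt γ (f (γ t)) t) (hη : ∀ t, HasDerivAt η (f (η t)) t) {t : ℝ}
    (ht : t ≤ 0) : dist (γ t) (η t) ≤ dist (γ 0) (η 0) * Real.exp (K * -t) := by
  have hneg : LipschitzWith K (fun x ↦ -f x) := fun x y ↦ by simpa using hf x y
  have hrev {c : ℝ → E} (hc : ∀ t, HasDerivAt c (f (c t)) t) (s : ℝ) :
      HasDerivAt (fun s ↦ c (-s)) (-f (c (-s))) s := by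
    simpa [Function.comp_def] using (hc (-s)).scomp s (hasDerivAt_neg s)
  have h := dist_le_of_trajectories_ODE (v := fun _ x ↦ -f x) (f := fun s ↦ γ (-s))
    (g := fun s ↦ η (-s)) (a := 0) (b := -t) (δ := dist (γ 0) (η 0)) (fun _ ↦ hneg)
    (fun s _ ↦ (hrev hγ s).continuousAt.continuousWithinAt)
    (fun s _ ↦ (hrev hγ s).hasDerivWithinAt)
    (fun s _ ↦ (hrev hη s).continuousAt.continuousWithinAt)
    (fun s _ ↦ (hrev hη s).hasDerivWithinAt) (by simp) (-t) ⟨by linarith, le_rfl⟩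
  simpa using h

/-- **Barbalat's lemma**: a function with a limit at infinity and a uniformly continuous
derivative has a derivative tending to zero. -/
lemma tendsto_deriv_zero_of_uniformContinuous {g g' : ℝ → ℝ} {l : ℝ}
    (hg : ∀ t, HasDerivAt g (g' t) t) (hu : UniformContinuous g')
    (hl : Tendsto g atTop (𝓝 l)) : Tendsto g' atTop (𝓝 0) := by
  rw [Metric.tendsto_atTop]
  intro ε hε
  obtain ⟨δ, hδ, hδε⟩ := Metric.uniformContinuous_iff.1 hu (ε / 2) (by positivity)
  have hd : Tendsto (fun t ↦ g (t + δ / 2) - g t) atTop (𝓝 0) := by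
    simpa using (hl.comp (tendsto_atTop_add_const_right _ (δ / 2) tendsto_id)).sub hl
  obtain ⟨N, hN⟩ := Metric.tendsto_atTop.1 hd (ε / 2 * (δ / 2)) (by positivity)
  refine ⟨N, fun t ht ↦ ?_⟩
  obtain ⟨s, hs, hs'⟩ := exists_hasDerivAt_eq_slope g g' (show t < t + δ / 2 by linarith)
    (fun s _ ↦ (hg s).continuousAt.continuousWithinAt) (fun s _ ↦ hg s)
  have h1 := hN t ht
  have h2 : dist t s < δ := by
    rw [Real.dist_eq, abs_lt]
    constructor <;> linarith [hs.1, hs.2]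
  have h3 := hδε h2
  have h4 : |g' s| < ε / 2 := by
    rw [hs', show t + δ / 2 - t = δ / 2 by ring, abs_div, abs_of_pos (half_pos hδ),
      div_lt_iff₀ (half_pos hδ)]
    simpa [Real.dist_eq] using h1
  rw [Real.dist_eq] at h3 ⊢
  rw [sub_zero]
  calc |g' t| = |(g' t - g' s) + g' s| := by ring_nf
    _ ≤ |g' t - g' s| + |g' s| := abs_add_le _ _
    _ < ε := by linarith

lemma HasDerivAt.mul_exp_neg {f : ℝ → ℝ} {d t : ℝ} (hf : HasDerivAt f d t) (c : ℝ) :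
    HasDerivAt (fun s ↦ f s * Real.exp (-(c * s))) ((d - c * f t) * Real.exp (-(c * t))) t := by
  have he : HasDerivAt (fun s ↦ Real.exp (-(c * s))) (Real.exp (-(c * t)) * -(c * 1)) t :=
    ((hasDerivAt_id t).const_mul c).neg.exp
  exact (hf.mul he).congr_deriv (by ring)

/-- A function with nonpositive derivative whenever it exceeds `M` never exceeds `M` later on. -/
lemma le_of_deriv_nonpos_above {g g' : ℝ → ℝ} {M a : ℝ} (hg : ∀ t, HasDerivAt g (g' t) t)
    (ha : g a ≤ M) (h : ∀ t, M < g t → g' t ≤ 0) {t : ℝ} (ht : a ≤ t) : g t ≤ M := by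
  by_contra! hMt
  have hcont : Continuous g := continuous_iff_continuousAt.2 fun s ↦ (hg s).continuousAt
  have hcpt : IsCompact (Icc a t ∩ {s | g s ≤ M}) :=
    isCompact_Icc.inter_right (isClosed_le hcont continuous_const)
  obtain ⟨s, ⟨hs, hsM⟩, hmax⟩ := hcpt.exists_isGreatest ⟨a, ⟨le_rfl, ht⟩, ha⟩
  have hanti : AntitoneOn g (Icc s t) := by
    refine antitoneOn_of_hasDerivWithinAt_nonpos (f' := g') (convex_Icc s t)
      hcont.continuousOn (fun r _ ↦ (hg r).hasDerivWithinAt) fun r hr ↦ h r ?_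
    rw [interior_Icc] at hr
    by_contra! hrM
    exact absurd (hmax ⟨⟨hs.1.trans hr.1.le, hr.2.le⟩, hrM⟩) (not_le.2 hr.1)
  exact absurd (hanti ⟨le_rfl, hs.2⟩ ⟨hs.2, le_rfl⟩ hs.2) (not_le.2 (lt_of_le_of_lt hsM hMt))

lemma eventually_pos_left_of_deriv_neg {g : ℝ → ℝ} {d b : ℝ} (hg : HasDerivAt g d b)
    (hb : g b = 0) (hd : d < 0) : ∀ᶠ t in 𝓝[<] b, 0 < g t := by
  have h := (hasDerivAt_iff_tendsto_slope.1 hg).mono_left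
    (nhdsWithin_mono b (fun t (ht : t < b) ↦ ht.ne))
  filter_upwards [h.eventually_lt_const hd, self_mem_nhdsWithin] with t ht htb
  rw [slope_def_field, hb, sub_zero, div_neg_iff] at ht
  have htb : t < b := htb
  rcases ht with ht | ht
  · exact ht.1
  · linarith [ht.2]

lemma eventually_neg_right_of_deriv_neg {g : ℝ → ℝ} {d b : ℝ} (hg : HasDerivAt g d b)
    (hb : g b = 0) (hd : d < 0) : ∀ᶠ t in 𝓝[>] b, g t < 0 := by
  have h := (hasDerivAt_iff_tendsto_slope.1 hg).mono_left
    (nhdsWithin_mono b (fun t (ht : b < t) ↦ ht.ne'))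
  filter_upwards [h.eventually_lt_const hd, self_mem_nhdsWithin] with t ht htb
  rw [slope_def_field, hb, sub_zero, div_neg_iff] at ht
  have htb : b < t := htb
  rcases ht with ht | ht
  · linarith [ht.2]
  · exact ht.1

/-- A barrier argument: a function which can only reach zero with negative slope stays negative. -/
lemma neg_of_forall_first_zero_deriv_neg {g g' : ℝ → ℝ} {a b : ℝ}
    (hg : ∀ t, HasDerivAt g (g' t) t) (ha : g a < 0)
    (h : ∀ t ∈ Icc a b, g t = 0 → (∀ s ∈ Ico a t, g s < 0) → g' t < 0) :
    ∀ t ∈ Icc a b, g t < 0 := by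
  intro t ht
  by_contra! hgt
  have hcont : Continuous g := continuous_iff_continuousAt.2 fun s ↦ (hg s).continuousAt
  have hcpt : IsCompact (Icc a t ∩ {s | 0 ≤ g s}) :=
    isCompact_Icc.inter_right (isClosed_le continuous_const hcont)
  obtain ⟨s, ⟨hs, hs0⟩, hmin⟩ := hcpt.exists_isLeast ⟨t, ⟨ht.1, le_rfl⟩, hgt⟩
  have hbefore : ∀ r ∈ Ico a s, g r < 0 := fun r hr ↦ by
    by_contra! hr0
    exact absurd (hmin ⟨⟨hr.1, hr.2.le.trans hs.2⟩, hr0⟩) (not_le.2 hr.2)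
  have has : a < s := lt_of_le_of_ne hs.1 fun h ↦ by
    rw [← h] at hs0
    exact absurd hs0 (not_le.2 ha)
  have hleft : ∀ᶠ r in 𝓝[<] s, g r < 0 := by
    filter_upwards [Ioo_mem_nhdsLT has] with r hr using hbefore r ⟨hr.1.le, hr.2⟩
  have hzero : g s = 0 := le_antisymm
    (le_of_tendsto (hcont.continuousAt.mono_left nhdsWithin_le_nhds)
      (hleft.mono fun r hr ↦ hr.le)) hs0
  obtain ⟨r, hr, hr'⟩ := (hleft.and (eventually_pos_left_of_deriv_neg (hg s) hzero
    (h s ⟨hs.1, hs.2.trans ht.2⟩ hzero hbefore))).exists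
  linarith

/-- A continuous function without zeros on an open interval which is negative somewhere in it is
negative throughout. -/
lemma neg_of_no_zero {g : ℝ → ℝ} (hg : Continuous g) {I : Set ℝ} (hI : I.OrdConnected)
    (h0 : ∀ t ∈ I, g t ≠ 0) {s : ℝ} (hs : s ∈ I) (hgs : g s < 0) : ∀ t ∈ I, g t < 0 := by
  intro t ht
  by_contra! hgt
  obtain ⟨r, hr, hr0⟩ := hI.isPreconnected.intermediate_value hs ht hg.continuousOn ⟨hgs.le, hgt⟩
  exact h0 r hr hr0

/-- After a transversal zero reached from above, a function is negative until its next zero. -/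
lemma sign_change_of_simple_zero {g : ℝ → ℝ} (hg : Continuous g) {d b c : ℝ} (hbc : b < c)
    (hd : HasDerivAt g d b) (hb : g b = 0) (hd0 : d ≠ 0) (hleft : ∀ᶠ t in 𝓝[<] b, 0 < g t)
    (hne : ∀ t ∈ Ioo b c, g t ≠ 0) : d < 0 ∧ ∀ t ∈ Ioo b c, g t < 0 := by
  have hneg : d < 0 := by
    refine lt_of_le_of_ne (not_lt.1 fun hpos ↦ ?_) hd0
    obtain ⟨t, h1, h2⟩ := (hleft.and (eventually_pos_left_of_deriv_neg hd.neg
      (by simp [hb]) (neg_neg_of_pos hpos))).exists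
    rw [Pi.neg_apply] at h2
    linarith
  obtain ⟨s, hs, hsI⟩ := ((eventually_neg_right_of_deriv_neg hd hb hneg).and
    (Ioo_mem_nhdsGT hbc)).exists
  exact ⟨hneg, neg_of_no_zero hg ordConnected_Ioo hne hsI hs⟩

/-- The zeros of a function which is positive on `(-∞, 0]`, has only simple zeros and has
arbitrarily large zeros form an increasing sequence of sign changes. -/
lemma exists_zero_sequence {ψ ψ' : ℝ → ℝ} (hψ : ∀ t, HasDerivAt ψ (ψ' t) t)
    (hpos : ∀ t ≤ 0, 0 < ψ t) (hsimple : ∀ t, ψ t = 0 → ψ' t ≠ 0)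
    (hinf : ∀ t, ∃ s, t ≤ s ∧ ψ s = 0) :
    ∃ T : ℕ → ℝ, StrictMono T ∧ Tendsto T atTop atTop ∧ (∀ i, ψ (T i) = 0) ∧
      (∀ t < T 0, 0 < ψ t) ∧
      (∀ m, ψ' (T (2 * m)) < 0 ∧ ∀ t ∈ Ioo (T (2 * m)) (T (2 * m + 1)), ψ t < 0) ∧
      (∀ m, 0 < ψ' (T (2 * m + 1)) ∧
        ∀ t ∈ Ioo (T (2 * m + 1)) (T (2 * m + 2)), 0 < ψ t) := by
  have hcont : Continuous ψ := continuous_iff_continuousAt.2 fun s ↦ (hψ s).continuousAt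
  have hisol (t : ℝ) : ∀ᶠ s in 𝓝[≠] t, ψ s ≠ 0 := by
    rcases eq_or_ne (ψ t) 0 with h0 | h0
    · exact (hψ t).eventually_ne (hsimple t h0)
    · exact (hcont.continuousAt.eventually_ne h0).filter_mono nhdsWithin_le_nhds
  have hnext (t : ℝ) : ∃ s, t < s ∧ ψ s = 0 ∧ ∀ r ∈ Ioo t s, ψ r ≠ 0 := by
    obtain ⟨u, htu, hu⟩ := mem_nhdsGT_iff_exists_Ioo_subset.1
      ((hisol t).filter_mono (nhdsWithin_mono t fun s (hs : t < s) ↦ hs.ne'))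
    have htu : t < u := htu
    obtain ⟨v, huv, hv⟩ := hinf u
    have hcpt : IsCompact (Icc u v ∩ {s | ψ s = 0}) :=
      isCompact_Icc.inter_right (isClosed_eq hcont continuous_const)
    obtain ⟨s, ⟨hs, hs0⟩, hmin⟩ := hcpt.exists_isLeast ⟨v, ⟨huv, le_rfl⟩, hv⟩
    refine ⟨s, htu.trans_le hs.1, hs0, fun r hr hr0 ↦ ?_⟩
    rcases lt_or_ge r u with hru | hur
    · exact hu ⟨hr.1, hru⟩ hr0
    · exact absurd (hmin ⟨⟨hur, hr.2.le.trans hs.2⟩, hr0⟩) (not_le.2 hr.2)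
  choose nxt hlt hzero hbetween using hnext
  let T : ℕ → ℝ := fun i ↦ nxt^[i + 1] 0
  have hTsucc (i : ℕ) : T (i + 1) = nxt (T i) := Function.iterate_succ_apply' _ _ _
  have hT0 : T 0 = nxt 0 := rfl
  have hmono : StrictMono T := strictMono_nat_of_lt_succ fun i ↦ by
    rw [hTsucc]
    exact hlt _
  have hTzero (i : ℕ) : ψ (T i) = 0 := by
    cases i with
    | zero => exact hzero 0
    | succ i => rw [hTsucc]; exact hzero _
  have hTbetween (i : ℕ) : ∀ t ∈ Ioo (T i) (T (i + 1)), ψ t ≠ 0 := by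
    rw [hTsucc]
    exact hbetween _
  have htop : Tendsto T atTop atTop := by
    rcases tendsto_atTop_of_monotone hmono.monotone with h | ⟨l, hl⟩
    · exact h
    · have hl' : Tendsto T atTop (𝓝[≠] l) := tendsto_nhdsWithin_iff.2
        ⟨hl, Eventually.of_forall fun i ↦
          ((hmono (Nat.lt_succ_self i)).trans_le (hmono.monotone.ge_of_tendsto hl _)).ne⟩
      obtain ⟨i, hi⟩ := (hl'.eventually (hisol l)).exists
      exact absurd (hTzero i) hi
  have hinit : ∀ t < T 0, 0 < ψ t := by
    have h := neg_of_no_zero hcont.neg (I := Iio (T 0)) ordConnected_Iio (fun t ht h0 ↦ ?_)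
      (s := 0) (hlt 0) (by simpa using hpos 0 le_rfl)
    · intro t ht
      simpa using h t ht
    · have h0 : ψ t = 0 := by simpa using h0
      rcases le_or_gt t 0 with h | h
      · exact (hpos t h).ne' h0
      · exact hbetween 0 t ⟨h, ht⟩ h0
  have hsign (i : ℕ) : (-1) ^ i * ψ' (T i) < 0 ∧
      ∀ t ∈ Ioo (T i) (T (i + 1)), (-1) ^ i * ψ t < 0 := by
    have hstep (i : ℕ) (hleft : ∀ᶠ t in 𝓝[<] (T i), 0 < (-1) ^ i * ψ t) :
        (-1) ^ i * ψ' (T i) < 0 ∧ ∀ t ∈ Ioo (T i) (T (i + 1)), (-1) ^ i * ψ t < 0 := by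
      have hunit : (-1 : ℝ) ^ i ≠ 0 := pow_ne_zero _ (by norm_num)
      exact sign_change_of_simple_zero (hcont.const_mul _) (hmono (Nat.lt_succ_self i))
        ((hψ (T i)).const_mul ((-1) ^ i)) (by simp [hTzero])
        (mul_ne_zero hunit (hsimple _ (hTzero i))) hleft
        fun t ht ↦ mul_ne_zero hunit (hTbetween i t ht)
    induction i with
    | zero =>
      refine hstep 0 ?_
      filter_upwards [self_mem_nhdsWithin] with t ht
      simpa using hinit t ht
    | succ i ih =>
      refine hstep (i + 1) ?_
      filter_upwards [Ioo_mem_nhdsLT (hmono (Nat.lt_succ_self i))] with t ht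
      have := ih.2 t ht
      rw [pow_succ]
      linarith
  refine ⟨T, hmono, htop, hTzero, hinit, fun m ↦ ?_, fun m ↦ ?_⟩
  · simpa using hsign (2 * m)
  · simpa [pow_succ] using hsign (2 * m + 1)

/-- A decaying oscillator `u'' = -a(t) u' - b(t) u` whose coefficients stay in the underdamped
range has velocity zeros at arbitrarily late times. -/
lemma exists_velocity_zero_of_underdamped {u ψ a b : ℝ → ℝ} {α β : ℝ}
    (hu : ∀ t, HasDerivAt u (ψ t) t) (hψ : ∀ t, HasDerivAt ψ (-a t * ψ t - b t * u t) t)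
    (ha : Tendsto a atTop (𝓝 α)) (hb : Tendsto b atTop (𝓝 β)) (hαβ : α ^ 2 < 4 * β)
    (hu0 : Tendsto u atTop (𝓝 0)) (t₀ : ℝ) : ∃ t, t₀ ≤ t ∧ ψ t = 0 := by
  by_contra! hne
  have hψcont : Continuous ψ := continuous_iff_continuousAt.2 fun s ↦ (hψ s).continuousAt
  have hucont : Continuous u := continuous_iff_continuousAt.2 fun s ↦ (hu s).continuousAt
  have hu_ne : ∀ t ≥ t₀, u t ≠ 0 := by
    have key {v η : ℝ → ℝ} (hv : ∀ t, HasDerivAt v (η t) t) (hη : ∀ t ∈ Ici t₀, η t < 0)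
        (hv0 : Tendsto v atTop (𝓝 0)) : ∀ t ≥ t₀, v t ≠ 0 := by
      have hanti : StrictAntiOn v (Ici t₀) := strictAntiOn_of_hasDerivWithinAt_neg
        (f' := η) (convex_Ici t₀) (fun t _ ↦ (hv t).continuousAt.continuousWithinAt)
        (fun t _ ↦ (hv t).hasDerivWithinAt) fun t ht ↦ hη t (interior_subset ht)
      intro t ht h0
      have h1 : v (t + 1) < 0 := h0 ▸ hanti ht (show t₀ ≤ t + 1 by linarith [ht.le]) (by linarith)
      have h2 : (0 : ℝ) ≤ v (t + 1) := le_of_tendsto hv0 <| by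
        filter_upwards [eventually_ge_atTop (t + 1)] with s hs
        exact hanti.antitoneOn (show t₀ ≤ t + 1 by linarith [ht.le])
          (show t₀ ≤ s by linarith [ht.le]) hs
      linarith
    rcases lt_or_gt_of_ne (hne t₀ le_rfl) with h | h
    · exact key hu (neg_of_no_zero hψcont ordConnected_Ici hne self_mem_Ici h) hu0
    · intro t ht h0
      exact key (fun t ↦ (hu t).neg) (neg_of_no_zero hψcont.neg ordConnected_Ici
        (fun t ht ↦ neg_ne_zero.2 (hne t ht)) self_mem_Ici (neg_neg_of_pos h))
        (by have := hu0.neg; rwa [neg_zero] at this) t ht (by simp [h0])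
  obtain ⟨η, hη, hη1, hηd⟩ : ∃ η > 0, η < 1 ∧ α ^ 2 < 4 * (1 - η) * (β - η) := by
    have hc : ContinuousAt (fun η : ℝ ↦ 4 * (1 - η) * (β - η)) 0 := by fun_prop
    have h := hc.eventually_const_lt (show α ^ 2 < 4 * (1 - 0) * (β - 0) by simpa using hαβ)
    obtain ⟨η, h1, h2⟩ := ((h.filter_mono nhdsWithin_le_nhds).and
      (Ioo_mem_nhdsGT (zero_lt_one' ℝ))).exists
    exact ⟨η, h2.1, h2.2, h1⟩
  have hev : ∀ᶠ t in atTop, a t ^ 2 < 4 * (1 - η) * (b t - η) :=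
    (ha.pow 2).eventually_lt ((hb.sub_const η).const_mul _) hηd
  obtain ⟨t₁, ht₁⟩ := eventually_atTop.1 (hev.and (eventually_ge_atTop t₀))
  have hslope (t : ℝ) (ht : t₁ ≤ t) : HasDerivAt (fun t ↦ Real.arctan (ψ t / u t) + η * t)
      (1 / (1 + (ψ t / u t) ^ 2) *
        (((-a t * ψ t - b t * u t) * u t - ψ t * ψ t) / u t ^ 2) + η * 1) t :=
    ((hψ t).div (hu t) (hu_ne t (ht₁ t ht).2)).arctan.add ((hasDerivAt_id t).const_mul η)
  have hanti : AntitoneOn (fun t ↦ Real.arctan (ψ t / u t) + η * t) (Ici t₁) := by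
    refine antitoneOn_of_hasDerivWithinAt_nonpos (convex_Ici t₁)
      (fun t ht ↦ (hslope t ht).continuousAt.continuousWithinAt)
      (fun t ht ↦ (hslope t (interior_subset ht)).hasDerivWithinAt) fun t ht ↦ ?_
    have ht := ht₁ t (interior_subset ht)
    have hut := hu_ne t ht.2
    set w := ψ t / u t with hw
    have hderiv : ((-a t * ψ t - b t * u t) * u t - ψ t * ψ t) / u t ^ 2
        = -(w ^ 2 + a t * w + b t) := by
      rw [hw]
      field_simp
      ring
    rw [hderiv, one_div_mul_eq_div]
    have : -(w ^ 2 + a t * w + b t) / (1 + w ^ 2) ≤ -η := by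
      rw [div_le_iff₀ (by positivity)]
      have h1 : 0 < 1 - η := by linarith
      nlinarith [sq_nonneg (2 * (1 - η) * w + a t), ht.1]
    linarith
  have hlate := hanti (show t₁ ≤ t₁ by rfl)
    (show t₁ ≤ t₁ + Real.pi / η by linarith [div_pos Real.pi_pos hη])
    (by linarith [div_pos Real.pi_pos hη])
  have h1 := Real.arctan_lt_pi_div_two (ψ t₁ / u t₁)
  have h2 := Real.neg_pi_div_two_lt_arctan
    (ψ (t₁ + Real.pi / η) / u (t₁ + Real.pi / η))
  have h3 : η * (t₁ + Real.pi / η) = η * t₁ + Real.pi := by field_simp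
  simp only at hlate
  linarith
/-- The field of (ODE2) with `n = p + 1` and `λ² = L` in the coordinates `(φ, θ)`, `θ = φ + ψ`. -/
noncomputable def coneField (p L : ℝ) (z : ℝ × ℝ) : ℝ × ℝ :=
  (z.2 - z.1,
    (1 + z.2 ^ 2) * ((p * L * z.1 - (1 + L * z.1 ^ 2 + p) * z.2) / (1 + L * z.1 ^ 2)))

/-- The square `[0, M]²`. -/
def square (M : ℝ) : Set (ℝ × ℝ) := Icc 0 M ×ˢ Icc 0 M

/-- The nearest point retraction of the line onto `[0, M]`. -/
noncomputable def clamp (M x : ℝ) : ℝ := max 0 (min M x)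

/-- The field `coneField` frozen outside the square `[0, M]²`. -/
noncomputable def clampedField (p L M : ℝ) (z : ℝ × ℝ) : ℝ × ℝ :=
  coneField p L (clamp M z.1, clamp M z.2)

lemma clamp_mem {M : ℝ} (hM : 0 ≤ M) (x : ℝ) : clamp M x ∈ Icc 0 M :=
  ⟨le_max_left _ _, max_le hM (min_le_left _ _)⟩

lemma clamp_of_mem {M x : ℝ} (hx : x ∈ Icc 0 M) : clamp M x = x := by
  rw [clamp, min_eq_right hx.2, max_eq_right hx.1]

lemma clamp_of_ge {M x : ℝ} (hM : 0 ≤ M) (hx : M ≤ x) : clamp M x = M := by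
  rw [clamp, min_eq_left hx, max_eq_right hM]

lemma clamp_of_nonpos {M x : ℝ} (hx : x ≤ 0) : clamp M x = 0 :=
  max_eq_left ((min_le_right _ _).trans hx)

lemma lipschitzWith_clamp (M : ℝ) : LipschitzWith 1 (clamp M) :=
  (LipschitzWith.id.const_min M).const_max 0

lemma clampedField_of_mem {p L M : ℝ} {z : ℝ × ℝ} (hz : z ∈ square M) :
    clampedField p L M z = coneField p L z := by
  rw [clampedField, clamp_of_mem hz.1, clamp_of_mem hz.2]

lemma isCompact_square (M : ℝ) : IsCompact (square M) := isCompact_Icc.prod isCompact_Icc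

lemma contDiff_coneField (p : ℝ) {L : ℝ} (hL : 0 ≤ L) : ContDiff ℝ 1 (coneField p L) := by
  have hW (z : ℝ × ℝ) : 1 + L * z.1 ^ 2 ≠ 0 := by positivity
  unfold coneField
  fun_prop (disch := exact hW _)

lemma exists_lipschitzOnWith_coneField (p M : ℝ) {L : ℝ} (hL : 0 ≤ L) :
    ∃ K, LipschitzOnWith K (coneField p L) (square M) :=
  (contDiff_coneField p hL).contDiffOn.exists_lipschitzOnWith one_ne_zero
    ((convex_Icc 0 M).prod (convex_Icc 0 M)) (isCompact_square M)

lemma exists_lipschitzWith_clampedField (p : ℝ) {L M : ℝ} (hL : 0 ≤ L) (hM : 0 ≤ M) :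
    ∃ K, LipschitzWith K (clampedField p L M) := by
  obtain ⟨K, hK⟩ := exists_lipschitzOnWith_coneField p M hL
  have hclamp : LipschitzWith 1 (fun z : ℝ × ℝ ↦ (clamp M z.1, clamp M z.2)) := by
    simpa using ((lipschitzWith_clamp M).comp LipschitzWith.prod_fst).prodMk
      ((lipschitzWith_clamp M).comp LipschitzWith.prod_snd)
  refine ⟨K * 1, lipschitzOnWith_univ.1 (hK.comp hclamp.lipschitzOnWith fun z _ ↦ ?_)⟩
  exact ⟨clamp_mem hM _, clamp_mem hM _⟩

lemma exists_bound_clampedField (p : ℝ) {L M : ℝ} (hL : 0 ≤ L) (hM : 0 ≤ M) :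
    ∃ C : NNReal, ∀ z, ‖clampedField p L M z‖ ≤ C := by
  obtain ⟨C, hC⟩ := (isCompact_square M).exists_bound_of_continuousOn
    (contDiff_coneField p hL).continuous.continuousOn
  refine ⟨C.toNNReal, fun z ↦ (hC _ ?_).trans (Real.le_coe_toNNReal C)⟩
  exact ⟨clamp_mem hM _, clamp_mem hM _⟩

lemma HasDerivAt.coord_fst {γ : ℝ → ℝ × ℝ} {v : ℝ × ℝ} {t : ℝ} (h : HasDerivAt γ v t) :
    HasDerivAt (fun s ↦ (γ s).1) v.1 t :=
  (ContinuousLinearMap.fst ℝ ℝ ℝ).hasFDerivAt.comp_hasDerivAt t h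

lemma HasDerivAt.coord_snd {γ : ℝ → ℝ × ℝ} {v : ℝ × ℝ} {t : ℝ} (h : HasDerivAt γ v t) :
    HasDerivAt (fun s ↦ (γ s).2) v.2 t :=
  (ContinuousLinearMap.snd ℝ ℝ ℝ).hasFDerivAt.comp_hasDerivAt t h

/-- The square is forward invariant under the frozen field. -/
lemma mem_square_of_le {p L M : ℝ} (hp : 0 ≤ p) (hL : 1 ≤ L) (hM : p * L ≤ M) {γ : ℝ → ℝ × ℝ}
    (hγ : ∀ t, HasDerivAt γ (clampedField p L M (γ t)) t) {a t : ℝ} (ha : γ a ∈ square M)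
    (ht : a ≤ t) : γ t ∈ square M := by
  have hM0 : 0 ≤ M := (by positivity : 0 ≤ p * L).trans hM
  have h1 (t : ℝ) := (hγ t).coord_fst
  have h2 (t : ℝ) := (hγ t).coord_snd
  refine ⟨⟨?_, ?_⟩, ?_, ?_⟩
  · have := le_of_deriv_nonpos_above (M := 0) (fun t ↦ (h1 t).neg) (by simpa using ha.1.1)
      (fun t ht ↦ ?_) ht
    · simpa using this
    · have ht : (γ t).1 < 0 := by simpa using ht
      have := (clamp_mem hM0 (γ t).2).1
      simp only [clampedField, coneField, clamp_of_nonpos ht.le]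
      linarith
  · refine le_of_deriv_nonpos_above h1 ha.1.2 (fun t ht ↦ ?_) ht
    have := (clamp_mem hM0 (γ t).2).2
    simp only [clampedField, coneField, clamp_of_ge hM0 ht.le]
    linarith
  · have := le_of_deriv_nonpos_above (M := 0) (fun t ↦ (h2 t).neg) (by simpa using ha.2.1)
      (fun t ht ↦ ?_) ht
    · simpa using this
    · have ht : (γ t).2 < 0 := by simpa using ht
      have := (clamp_mem hM0 (γ t).1).1
      simp only [clampedField, coneField, clamp_of_nonpos ht.le, neg_nonpos]
      rw [mul_zero, sub_zero]
      positivity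
  · refine le_of_deriv_nonpos_above h2 ha.2.2 (fun t ht ↦ ?_) ht
    obtain ⟨hx, -⟩ := clamp_mem hM0 (γ t).1
    simp only [clampedField, coneField, clamp_of_ge hM0 ht.le]
    set x := clamp M (γ t).1
    refine mul_nonpos_of_nonneg_of_nonpos (by positivity) (div_nonpos_of_nonpos_of_nonneg ?_
      (by positivity))
    have : p * L * x ≤ M * (1 + x ^ 2) := by
      nlinarith [mul_le_mul_of_nonneg_right hM hx, sq_nonneg (x - 1)]
    nlinarith [mul_nonneg hM0 (sq_nonneg x), mul_nonneg hM0 hp]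

/-- The remainder of `coneField` along the unstable direction at the origin is cubic. -/
lemma exists_cubic_remainder_bound {p k L : ℝ} (hp : 0 ≤ p) (hk : 0 ≤ k) (hL : 0 ≤ L)
    (hpL : p * L = k * (k + p)) :
    ∃ K > 0, ∀ x y : ℝ, 0 ≤ x → x ≤ 1 → 0 ≤ y → y ≤ (k + 1) * x →
      |(coneField p L (x, y)).2 - k * (coneField p L (x, y)).1 + (k + p + 1) * (y - k * x)|
        ≤ K * x ^ 3 := by
  set S := p * L + (1 + p) * (k + 1) with hS
  have hS0 : 0 ≤ S := by positivity
  refine ⟨(k + 1) ^ 2 * (S + L * (k + 1)) + L * (k + 1 + S) + 1, by positivity,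
    fun x y hx hx1 hy hyx ↦ ?_⟩
  have hW : 1 ≤ 1 + L * x ^ 2 := by linarith [mul_nonneg hL (sq_nonneg x)]
  have hW0 : 0 < 1 + L * x ^ 2 := by linarith
  set H₀ := p * L * x - (1 + p) * y with hH₀
  have hH₀S : |H₀| ≤ S * x := by
    rw [abs_le]
    constructor <;> nlinarith [mul_nonneg (mul_nonneg hp hL) hx, mul_nonneg hp hy,
      mul_le_mul_of_nonneg_left hyx hp]
  have hdiv (a : ℝ) : |a / (1 + L * x ^ 2)| ≤ |a| := by
    rw [abs_div, abs_of_pos hW0]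
    exact div_le_self (abs_nonneg a) hW
  have hH : |(H₀ - L * x ^ 2 * y) / (1 + L * x ^ 2)| ≤ (S + L * (k + 1)) * x := by
    refine (hdiv _).trans ((abs_sub _ _).trans ?_)
    rw [abs_of_nonneg (by positivity : 0 ≤ L * x ^ 2 * y)]
    have h1 : x ^ 2 ≤ 1 := pow_le_one₀ hx hx1
    have h2 : L * x ^ 2 * y ≤ L * 1 * ((k + 1) * x) := by gcongr
    linarith
  have hdiff : |L * x ^ 2 * (y + H₀) / (1 + L * x ^ 2)| ≤ L * (k + 1 + S) * x ^ 3 := by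
    refine (hdiv _).trans ?_
    rw [abs_mul, abs_of_nonneg (by positivity : 0 ≤ L * x ^ 2)]
    have h1 : |y + H₀| ≤ (k + 1) * x + S * x :=
      (abs_add_le _ _).trans (add_le_add ((abs_of_nonneg hy).le.trans hyx) hH₀S)
    calc L * x ^ 2 * |y + H₀| ≤ L * x ^ 2 * ((k + 1) * x + S * x) := by gcongr
      _ = _ := by ring
  have hquad : |y ^ 2 * ((H₀ - L * x ^ 2 * y) / (1 + L * x ^ 2))|
      ≤ (k + 1) ^ 2 * (S + L * (k + 1)) * x ^ 3 := by
    rw [abs_mul, abs_of_nonneg (sq_nonneg y)]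
    calc y ^ 2 * _ ≤ ((k + 1) * x) ^ 2 * ((S + L * (k + 1)) * x) := by gcongr
      _ = _ := by ring
  have hsplit : (coneField p L (x, y)).2 - k * (coneField p L (x, y)).1
      + (k + p + 1) * (y - k * x) = y ^ 2 * ((H₀ - L * x ^ 2 * y) / (1 + L * x ^ 2))
        - L * x ^ 2 * (y + H₀) / (1 + L * x ^ 2) := by
    simp only [coneField, hH₀]
    field_simp
    linear_combination (x + L * x ^ 3) * hpL
  rw [hsplit]
  refine (abs_sub _ _).trans ?_
  nlinarith [pow_nonneg hx 3]

/-- A cubic neighbourhood, of width `δ`, of the unstable direction at the origin. -/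
def wedge (k C δ : ℝ) : Set (ℝ × ℝ) :=
  {z | 0 ≤ z.1 ∧ z.1 ≤ δ ∧ |z.2 - k * z.1| ≤ C * z.1 ^ 3}

lemma abs_sub_le_of_mem_wedge {k C δ : ℝ} (hC : 0 ≤ C) (hCδ : C * δ ^ 2 ≤ 1) {z : ℝ × ℝ}
    (hz : z ∈ wedge k C δ) : |z.2 - k * z.1| ≤ z.1 := by
  obtain ⟨h0, h1, h2⟩ := hz
  have h3 : C * z.1 ^ 2 ≤ 1 := hCδ.trans' (by gcongr)
  nlinarith

lemma wedge_subset_square {k C δ M : ℝ} (hk : 1 ≤ k) (hC : 0 ≤ C) (hδ : δ ≤ 1)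
    (hCδ : C * δ ^ 2 ≤ 1) (hM : k + 1 ≤ M) : wedge k C δ ⊆ square M := by
  intro z hz
  have h := abs_le.1 (abs_sub_le_of_mem_wedge hC hCδ hz)
  obtain ⟨h0, h1, -⟩ := hz
  refine ⟨⟨h0, ?_⟩, ?_, ?_⟩ <;> nlinarith

lemma isClosed_wedge (k C δ : ℝ) : IsClosed (wedge k C δ) := by
  have h : IsClosed {z : ℝ × ℝ | |z.2 - k * z.1| ≤ C * z.1 ^ 3} :=
    isClosed_le (by fun_prop) (by fun_prop)
  exact (isClosed_le continuous_const continuous_fst).inter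
    ((isClosed_le continuous_fst continuous_const).inter h)

/-- Solutions starting on the unstable direction stay in the wedge while `φ ≤ δ`. -/
lemma mem_wedge_of_start {p k L M C δ ε T : ℝ} (hp : 0 ≤ p) (hk : 3 ≤ k) (hL : 1 ≤ L)
    (hM : p * L ≤ M) (hkM : k + 1 ≤ M)
    (hC : 0 < C) (hδ : δ ≤ 1) (hCδ : C * δ ^ 2 ≤ 1)
    (hrem : ∀ x y : ℝ, 0 ≤ x → x ≤ 1 → 0 ≤ y → y ≤ (k + 1) * x →
      |(coneField p L (x, y)).2 - k * (coneField p L (x, y)).1 + (k + p + 1) * (y - k * x)|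
        ≤ C * x ^ 3)
    {γ : ℝ → ℝ × ℝ} (hγ : ∀ t, HasDerivAt γ (clampedField p L M (γ t)) t)
    (hε : 0 < ε) (h0 : γ 0 = (ε, k * ε)) (hT : ∀ s ∈ Icc 0 T, (γ s).1 ≤ δ) :
    ∀ s ∈ Icc 0 T, γ s ∈ wedge k C δ := by
  intro s₀ hs₀
  have hεδ : ε ≤ δ := by simpa [h0] using hT 0 ⟨le_rfl, hs₀.1.trans hs₀.2⟩
  have hsq {t : ℝ} (ht : 0 ≤ t) : γ t ∈ square M := by
    refine mem_square_of_le hp hL hM hγ (a := 0) ?_ ht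
    rw [h0]
    refine ⟨⟨?_, ?_⟩, ?_, ?_⟩ <;> nlinarith
  have h1 (t : ℝ) := (hγ t).coord_fst
  have h2 (t : ℝ) := (hγ t).coord_snd
  have hwedge {t : ℝ} (ht : t ∈ Icc 0 T)
      (hE : ((γ t).2 - k * (γ t).1) ^ 2 - C ^ 2 * (γ t).1 ^ 6 ≤ 0) : γ t ∈ wedge k C δ := by
    have hx := (hsq ht.1).1.1
    refine ⟨hx, hT t ht, abs_le_of_sq_le_sq ?_ (by positivity)⟩
    linarith [show (C * (γ t).1 ^ 3) ^ 2 = C ^ 2 * (γ t).1 ^ 6 by ring]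
  refine hwedge hs₀ (neg_of_forall_first_zero_deriv_neg (fun t ↦
    (((h2 t).sub ((h1 t).const_mul k)).pow 2).sub (((h1 t).pow 6).const_mul (C ^ 2)))
    ?_ (fun t ht hzero hneg ↦ ?_) s₀ hs₀).le
  · simp only [h0, Pi.sub_apply, Pi.pow_apply, sub_self]
    have : 0 < C ^ 2 * ε ^ 6 := by positivity
    linarith
  · have hw (s : ℝ) (hs : s ∈ Icc 0 t) : γ s ∈ wedge k C δ := by
      refine hwedge ⟨hs.1, hs.2.trans ht.2⟩ ?_
      rcases eq_or_lt_of_le hs.2 with rfl | hst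
      · exact hzero.le
      · exact (hneg s ⟨hs.1, hst⟩).le
    have hmono : MonotoneOn (fun s ↦ (γ s).1) (Icc 0 t) := by
      refine monotoneOn_of_hasDerivWithinAt_nonneg (convex_Icc 0 t)
        (fun s _ ↦ (h1 s).continuousAt.continuousWithinAt)
        (fun s _ ↦ (h1 s).hasDerivWithinAt) fun s hs ↦ ?_
      have hs := hw s (interior_subset hs)
      rw [clampedField_of_mem (wedge_subset_square (by linarith) hC.le hδ hCδ hkM hs)]
      have := abs_le.1 (abs_sub_le_of_mem_wedge hC.le hCδ hs)
      simp only [coneField]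
      nlinarith [hs.1]
    have hpos : 0 < (γ t).1 := by
      have := hmono ⟨le_rfl, ht.1⟩ ⟨ht.1, le_rfl⟩ ht.1
      simp only [h0] at this
      linarith
    have hwt := hw t ⟨ht.1, le_rfl⟩
    have hlin := abs_le.1 (abs_sub_le_of_mem_wedge hC.le hCδ hwt)
    have hr := hrem (γ t).1 (γ t).2 hpos.le (hwt.2.1.trans hδ) (hsq ht.1).2.1 (by linarith)
    simp only [Pi.sub_apply, Pi.pow_apply] at hzero
    rw [clampedField_of_mem (hsq ht.1)]
    change |(coneField p L (γ t)).2 - k * (coneField p L (γ t)).1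
      + (k + p + 1) * ((γ t).2 - k * (γ t).1)| ≤ _ at hr
    have hφ : 0 ≤ (coneField p L (γ t)).1 := by
      simp only [coneField]
      nlinarith
    set v := (γ t).2 - k * (γ t).1
    set x := (γ t).1
    set R := (coneField p L (γ t)).2 - k * (coneField p L (γ t)).1
    have hvR : v * (R + (k + p + 1) * v) ≤ C ^ 2 * x ^ 6 := by
      refine (le_abs_self _).trans ?_
      rw [abs_mul]
      calc _ ≤ C * x ^ 3 * (C * x ^ 3) := by gcongr; exact hwt.2.2
        _ = _ := by ring
    have hCx : 0 < C ^ 2 * x ^ 6 := by positivity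
    have h5 : 0 ≤ C ^ 2 * (6 * x ^ 5 * (coneField p L (γ t)).1) := by positivity
    norm_num
    nlinarith

/-- For every time `N` there is a solution through the section `φ = δ` which has been in the
wedge since time `-N`. -/
lemma exists_mem_wedge_since {p k L M C δ : ℝ} (hp : 0 ≤ p) (hk : 3 ≤ k) (hL : 1 ≤ L)
    (hM : p * L ≤ M) (hkM : k + 1 ≤ M)
    (hC : 0 < C) (hδ0 : 0 < δ) (hδ : δ ≤ 1) (hCδ : C * δ ^ 2 ≤ 1)
    (hrem : ∀ x y : ℝ, 0 ≤ x → x ≤ 1 → 0 ≤ y → y ≤ (k + 1) * x →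
      |(coneField p L (x, y)).2 - k * (coneField p L (x, y)).1 + (k + p + 1) * (y - k * x)|
        ≤ C * x ^ 3) {N : ℝ} (hN : 0 ≤ N) :
    ∃ γ : ℝ → ℝ × ℝ, (∀ t, HasDerivAt γ (clampedField p L M (γ t)) t) ∧ (γ 0).1 = δ ∧
      ∀ t ∈ Icc (-N) 0, γ t ∈ wedge k C δ := by
  obtain ⟨K, hK⟩ := exists_lipschitzWith_clampedField p (by linarith : 0 ≤ L)
    (by linarith : 0 ≤ M)
  obtain ⟨B, hB⟩ := exists_bound_clampedField p (by linarith : 0 ≤ L) (by linarith : 0 ≤ M)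
  set ε := δ * Real.exp (-(k * N)) with hεdef
  have hε : 0 < ε := by positivity
  have hεδ : ε ≤ δ := mul_le_of_le_one_right hδ0.le (Real.exp_le_one_iff.2 (by
    have : 0 ≤ k * N := by positivity
    linarith))
  obtain ⟨γ, h0, hγ⟩ := exists_integral_curve_of_lipschitz_of_bounded hK hB (ε, k * ε)
  have h1 (t : ℝ) := (hγ t).coord_fst
  have hcont : Continuous fun t ↦ (γ t).1 :=
    continuous_iff_continuousAt.2 fun t ↦ (h1 t).continuousAt
  have hwedge {T : ℝ} (hT : ∀ s ∈ Icc 0 T, (γ s).1 ≤ δ) : ∀ s ∈ Icc 0 T, γ s ∈ wedge k C δ :=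
    mem_wedge_of_start hp hk hL hM hkM hC hδ hCδ hrem hγ hε h0 hT
  have hbounds {z : ℝ × ℝ} (hz : z ∈ wedge k C δ) :
      z.1 ≤ (clampedField p L M z).1 ∧ (clampedField p L M z).1 ≤ k * z.1 := by
    rw [clampedField_of_mem (wedge_subset_square (by linarith) hC.le hδ hCδ hkM hz)]
    have := abs_le.1 (abs_sub_le_of_mem_wedge hC.le hCδ hz)
    simp only [coneField]
    constructor <;> nlinarith [hz.1]
  have hexp (c t : ℝ) := (h1 t).mul_exp_neg c
  obtain ⟨T, hT0, hTδ⟩ : ∃ T, 0 ≤ T ∧ δ ≤ (γ T).1 := by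
    by_contra! hlt
    have hmono : MonotoneOn (fun t ↦ (γ t).1 * Real.exp (-(1 * t))) (Ici 0) := by
      refine monotoneOn_of_hasDerivWithinAt_nonneg (convex_Ici 0)
        (fun s _ ↦ (hexp 1 s).continuousAt.continuousWithinAt)
        (fun s _ ↦ (hexp 1 s).hasDerivWithinAt) fun s hs ↦ ?_
      have hs := interior_subset hs
      have := (hbounds (hwedge (T := s) (fun r hr ↦ (hlt r hr.1).le) s ⟨hs, le_rfl⟩)).1
      exact mul_nonneg (by linarith) (Real.exp_pos _).le
    have hge (t : ℝ) (ht : 0 ≤ t) : ε * Real.exp t ≤ (γ t).1 := by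
      have h := hmono self_mem_Ici ht ht
      simp only [h0, mul_zero, neg_zero, Real.exp_zero, mul_one, one_mul, Real.exp_neg] at h
      rwa [← div_eq_mul_inv, le_div_iff₀ (Real.exp_pos t)] at h
    have h3 := (Real.tendsto_exp_atTop.const_mul_atTop hε).eventually_gt_atTop δ
    obtain ⟨t, ht, ht0⟩ := (h3.and (eventually_ge_atTop 0)).exists
    linarith [hge t ht0, hlt t ht0]
  have hcpt : IsCompact (Icc 0 T ∩ {s | δ ≤ (γ s).1}) :=
    isCompact_Icc.inter_right (isClosed_le continuous_const hcont)
  obtain ⟨τ, ⟨hτ, hτδ⟩, hmin⟩ := hcpt.exists_isLeast ⟨T, ⟨hT0, le_rfl⟩, hTδ⟩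
  have hτδ : δ ≤ (γ τ).1 := hτδ
  have hbefore : ∀ s ∈ Ico 0 τ, (γ s).1 < δ := fun s hs ↦ by
    by_contra! h
    exact absurd (hmin ⟨⟨hs.1, hs.2.le.trans hτ.2⟩, h⟩) (not_le.2 hs.2)
  have hτeq : (γ τ).1 = δ := by
    refine le_antisymm ?_ hτδ
    rcases eq_or_lt_of_le hτ.1 with h | h
    · rw [← h, h0]
      exact hεδ
    · refine le_of_tendsto (hcont.continuousAt.mono_left (nhdsWithin_le_nhds (s := Iio τ))) ?_
      filter_upwards [Ioo_mem_nhdsLT h] with s hs using (hbefore s ⟨hs.1.le, hs.2⟩).le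
  have hin : ∀ s ∈ Icc 0 τ, γ s ∈ wedge k C δ := hwedge fun s hs ↦ by
    rcases eq_or_lt_of_le hs.2 with rfl | h
    · exact hτeq.le
    · exact (hbefore s ⟨hs.1, h⟩).le
  have hNτ : N ≤ τ := by
    have hanti : AntitoneOn (fun t ↦ (γ t).1 * Real.exp (-(k * t))) (Icc 0 τ) := by
      refine antitoneOn_of_hasDerivWithinAt_nonpos (convex_Icc 0 τ)
        (fun s _ ↦ (hexp k s).continuousAt.continuousWithinAt)
        (fun s _ ↦ (hexp k s).hasDerivWithinAt) fun s hs ↦ ?_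
      have := (hbounds (hin s (interior_subset hs))).2
      exact mul_nonpos_of_nonpos_of_nonneg (by linarith) (Real.exp_pos _).le
    have h := hanti ⟨le_rfl, hτ.1⟩ ⟨hτ.1, le_rfl⟩ hτ.1
    simp only [h0, hτeq, mul_zero, neg_zero, Real.exp_zero, mul_one] at h
    have h := Real.exp_le_exp.1 (le_of_mul_le_mul_left h hδ0)
    nlinarith
  refine ⟨fun t ↦ γ (t + τ), fun t ↦ (hγ (t + τ)).comp_add_const t τ, by simpa using hτeq,
    fun t ht ↦ hin _ ⟨by linarith [ht.1], by linarith [ht.2]⟩⟩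

/-- A solution through the section `φ = δ` which has always been in the wedge. -/
lemma exists_mem_wedge_backward {p k L M C δ : ℝ} (hp : 0 ≤ p) (hk : 3 ≤ k) (hL : 1 ≤ L)
    (hM : p * L ≤ M) (hkM : k + 1 ≤ M)
    (hC : 0 < C) (hδ0 : 0 < δ) (hδ : δ ≤ 1) (hCδ : C * δ ^ 2 ≤ 1)
    (hrem : ∀ x y : ℝ, 0 ≤ x → x ≤ 1 → 0 ≤ y → y ≤ (k + 1) * x →
      |(coneField p L (x, y)).2 - k * (coneField p L (x, y)).1 + (k + p + 1) * (y - k * x)|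
        ≤ C * x ^ 3) :
    ∃ γ : ℝ → ℝ × ℝ, (∀ t, HasDerivAt γ (clampedField p L M (γ t)) t) ∧ (γ 0).1 = δ ∧
      ∀ t ≤ 0, γ t ∈ wedge k C δ := by
  obtain ⟨K, hK⟩ := exists_lipschitzWith_clampedField p (by linarith : 0 ≤ L)
    (by linarith : 0 ≤ M)
  obtain ⟨B, hB⟩ := exists_bound_clampedField p (by linarith : 0 ≤ L) (by linarith : 0 ≤ M)
  choose γ hγ hδγ hw using fun N : ℕ ↦ exists_mem_wedge_since hp hk hL hM hkM hC hδ0 hδ hCδ hrem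
    (Nat.cast_nonneg (α := ℝ) N)
  have hcpt : IsCompact (wedge k C δ) := (isCompact_square M).of_isClosed_subset
    (isClosed_wedge k C δ) (wedge_subset_square (by linarith) hC.le hδ hCδ hkM)
  obtain ⟨x, hx, σ, hσ, hlim⟩ := hcpt.tendsto_subseq (x := fun N ↦ γ N 0)
    fun N ↦ hw N 0 ⟨by simp, le_rfl⟩
  obtain ⟨η, h0, hη⟩ := exists_integral_curve_of_lipschitz_of_bounded hK hB x
  refine ⟨η, hη, ?_, fun t ht ↦ ?_⟩
  · rw [h0]
    refine tendsto_nhds_unique ((continuous_fst.tendsto x).comp hlim) ?_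
    simp [Function.comp_def, hδγ]
  · have hconv : Tendsto (fun N ↦ γ (σ N) t) atTop (𝓝 (η t)) := by
      rw [tendsto_iff_dist_tendsto_zero]
      refine squeeze_zero (fun _ ↦ dist_nonneg)
        (fun N ↦ dist_integral_curves_le hK (hγ (σ N)) hη ht) ?_
      have := (tendsto_iff_dist_tendsto_zero.1 hlim).mul_const (Real.exp (K * -t))
      simpa [h0] using this
    refine (isClosed_wedge k C δ).mem_of_tendsto hconv ?_
    obtain ⟨N₀, hN₀⟩ := exists_nat_ge (-t)
    filter_upwards [eventually_ge_atTop N₀] with N hN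
    have : (N₀ : ℝ) ≤ σ N := by exact_mod_cast hN.trans (hσ.id_le N)
    exact hw _ t ⟨by linarith, ht⟩

/-- A function with `f' ≥ -c f` stays positive. -/
lemma pos_of_neg_mul_le_deriv {f f' : ℝ → ℝ} {c : ℝ} (hf : ∀ t, HasDerivAt f (f' t) t)
    (h0 : 0 < f 0) (h : ∀ t, 0 ≤ t → 0 ≤ f' t + c * f t) {t : ℝ} (ht : 0 ≤ t) : 0 < f t := by
  have hmono : MonotoneOn (fun t ↦ f t * Real.exp (-(-c * t))) (Ici 0) := by
    refine monotoneOn_of_hasDerivWithinAt_nonneg (convex_Ici 0)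
      (fun s _ ↦ ((hf s).mul_exp_neg (-c)).continuousAt.continuousWithinAt)
      (fun s _ ↦ ((hf s).mul_exp_neg (-c)).hasDerivWithinAt) fun s hs ↦ ?_
    have := h s (interior_subset hs)
    exact mul_nonneg (by linarith) (Real.exp_pos _).le
  have h1 := hmono self_mem_Ici ht ht
  simp only [mul_zero, neg_zero, Real.exp_zero, mul_one] at h1
  exact pos_of_mul_pos_left (h0.trans_le h1) (Real.exp_pos _).le

/-- Solutions which have always been in the wedge leave the origin at the rate `e^{(k-1)t}`. -/
lemma bounds_of_mem_wedge_backward {p k L C δ : ℝ} (hk : 3 ≤ k) (hC : 0 < C) (hδ0 : 0 < δ)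
    (hδ : δ ≤ 1) (hCδ : C * δ ^ 2 ≤ 1) {γ : ℝ → ℝ × ℝ}
    (hγ : ∀ t ≤ 0, HasDerivAt γ (coneField p L (γ t)) t)
    (h0 : (γ 0).1 = δ) (hw : ∀ t ≤ 0, γ t ∈ wedge k C δ) {t : ℝ} (ht : t ≤ 0) :
    0 < (γ t).1 ∧ (γ t).1 < (γ t).2 ∧
      (γ t).1 ≤ (k + 1) * Real.exp (1 / 2) * Real.exp ((k - 1) * t) ∧
      (γ t).2 ≤ (k + 1) * Real.exp (1 / 2) * Real.exp ((k - 1) * t) := by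
  have h1 (t : ℝ) (ht : t ≤ 0) : HasDerivAt (fun s ↦ (γ s).1) ((γ t).2 - (γ t).1) t :=
    (hγ t ht).coord_fst
  have hint {s : ℝ} (hs : s ∈ interior (Iic 0)) : s ≤ 0 := interior_subset (s := Iic 0) hs
  have hlin (t : ℝ) (ht : t ≤ 0) := abs_le.1 (abs_sub_le_of_mem_wedge hC.le hCδ (hw t ht))
  have hpos (t : ℝ) (ht : t ≤ 0) : 0 < (γ t).1 := by
    have hanti : AntitoneOn (fun t ↦ (γ t).1 * Real.exp (-(k * t))) (Iic 0) := by
      refine antitoneOn_of_hasDerivWithinAt_nonpos (convex_Iic 0)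
        (fun s hs ↦ ((h1 s hs).mul_exp_neg k).continuousAt.continuousWithinAt)
        (fun s hs ↦ ((h1 s (hint hs)).mul_exp_neg k).hasDerivWithinAt) fun s hs ↦ ?_
      have := hlin s (hint hs)
      exact mul_nonpos_of_nonpos_of_nonneg (by linarith) (Real.exp_pos _).le
    have h := hanti ht self_mem_Iic ht
    simp only [h0, mul_zero, neg_zero, Real.exp_zero, mul_one] at h
    exact pos_of_mul_pos_left (hδ0.trans_le h) (Real.exp_pos _).le
  have hrough (t : ℝ) (ht : t ≤ 0) : (γ t).1 ≤ δ * Real.exp t := by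
    have hmono : MonotoneOn (fun t ↦ (γ t).1 * Real.exp (-(1 * t))) (Iic 0) := by
      refine monotoneOn_of_hasDerivWithinAt_nonneg (convex_Iic 0)
        (fun s hs ↦ ((h1 s hs).mul_exp_neg 1).continuousAt.continuousWithinAt)
        (fun s hs ↦ ((h1 s (hint hs)).mul_exp_neg 1).hasDerivWithinAt) fun s hs ↦ ?_
      have := hlin s (hint hs)
      have := hpos s (hint hs)
      exact mul_nonneg (by nlinarith) (Real.exp_pos _).le
    have h := hmono ht self_mem_Iic ht
    simp only [h0, mul_zero, neg_zero, Real.exp_zero, mul_one, one_mul, Real.exp_neg] at h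
    rwa [← div_eq_mul_inv, div_le_iff₀ (Real.exp_pos t)] at h
  have hsharp : (γ t).1 ≤ Real.exp (1 / 2) * Real.exp ((k - 1) * t) := by
    have hcorr (t : ℝ) : HasDerivAt (fun t ↦ Real.exp (Real.exp (2 * t) / 2))
        (Real.exp (Real.exp (2 * t) / 2) * Real.exp (2 * t)) t :=
      ((((hasDerivAt_id t).const_mul 2).exp).div_const 2).exp.congr_deriv (by simp)
    have hmul (t : ℝ) (ht : t ≤ 0) := ((h1 t ht).mul (hcorr t)).mul_exp_neg (k - 1)
    have hmono : MonotoneOn (fun t ↦ ((fun s ↦ (γ s).1) * fun t ↦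
        Real.exp (Real.exp (2 * t) / 2)) t * Real.exp (-((k - 1) * t))) (Iic 0) := by
      refine monotoneOn_of_hasDerivWithinAt_nonneg (convex_Iic 0)
        (fun s hs ↦ (hmul s hs).continuousAt.continuousWithinAt)
        (fun s hs ↦ (hmul s (hint hs)).hasDerivWithinAt) fun s hs ↦ ?_
      have hs := hint hs
      have hφ := hpos s hs
      have hv := (abs_le.1 (hw s hs).2.2).1
      have hsq : C * (γ s).1 ^ 2 ≤ Real.exp (2 * s) := by
        calc C * (γ s).1 ^ 2 ≤ C * (δ * Real.exp s) ^ 2 := by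
              gcongr
              exact hrough s hs
          _ = (C * δ ^ 2) * Real.exp (2 * s) := by
              rw [two_mul, Real.exp_add]
              ring
          _ ≤ _ := mul_le_of_le_one_left (Real.exp_pos _).le hCδ
      have hcube : C * (γ s).1 ^ 3 ≤ Real.exp (2 * s) * (γ s).1 := by nlinarith
      have hfac : 0 ≤ Real.exp (Real.exp (2 * s) / 2) *
          ((γ s).2 - k * (γ s).1 + Real.exp (2 * s) * (γ s).1) :=
        mul_nonneg (Real.exp_pos _).le (by linarith)
      refine mul_nonneg (hfac.trans_eq ?_) (Real.exp_pos _).le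
      simp only [Pi.mul_apply]
      ring
    have h := hmono ht self_mem_Iic ht
    simp only [Pi.mul_apply, h0, mul_zero, neg_zero, Real.exp_zero, mul_one] at h
    have h2 : (γ t).1 * Real.exp (-((k - 1) * t)) ≤ Real.exp (1 / 2) := by
      refine (mul_le_mul_of_nonneg_right ?_ (Real.exp_pos _).le).trans (h.trans ?_)
      · exact le_mul_of_one_le_right (hpos t ht).le (Real.one_le_exp (by positivity))
      · exact mul_le_of_le_one_left (Real.exp_pos _).le hδ
    rwa [Real.exp_neg, ← div_eq_mul_inv, div_le_iff₀ (Real.exp_pos _)] at h2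
  have hE : 0 < Real.exp (1 / 2) * Real.exp ((k - 1) * t) := by positivity
  have h2 := hlin t ht
  have h3 := hpos t ht
  refine ⟨h3, ?_, ?_, ?_⟩ <;> nlinarith

/-- The branch of the unstable manifold of the origin in the open first quadrant. -/
lemma exists_unstable_curve {p k L : ℝ} (hp : 0 ≤ p) (hk : 3 ≤ k) (hL : 1 ≤ L)
    (hpL : p * L = k * (k + p)) :
    ∃ (M : ℝ) (γ : ℝ → ℝ × ℝ), (∀ t, HasDerivAt γ (coneField p L (γ t)) t) ∧
      (∀ t, γ t ∈ square M) ∧ (∀ t, 0 < (γ t).1) ∧ (∀ t, 0 < (γ t).2) ∧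
      (∀ t ≤ 0, (γ t).1 < (γ t).2) ∧
      ∃ A > 0, ∀ t ≤ 0, (γ t).1 ≤ A * Real.exp ((k - 1) * t) ∧
        (γ t).2 ≤ A * Real.exp ((k - 1) * t) := by
  obtain ⟨C, hC, hrem⟩ := exists_cubic_remainder_bound hp (by linarith : 0 ≤ k)
    (by linarith : 0 ≤ L) hpL
  obtain ⟨δ, hδ0, hδ, hCδ⟩ : ∃ δ > 0, δ ≤ 1 ∧ C * δ ^ 2 ≤ 1 := by
    refine ⟨1 / (C + 1), by positivity, ?_, ?_⟩
    · rw [div_le_one (by positivity)]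
      linarith
    · rw [div_pow, one_pow, mul_one_div, div_le_one (by positivity)]
      nlinarith
  set M := p * L with hM
  have hkM : k + 1 ≤ M := by nlinarith
  have hM0 : 0 ≤ M := by linarith
  obtain ⟨γ, hγ, h0, hw⟩ := exists_mem_wedge_backward hp hk hL le_rfl hkM hC hδ0 hδ hCδ hrem
  have hwsq := wedge_subset_square (by linarith) hC.le hδ hCδ hkM
  have hsq (t : ℝ) : γ t ∈ square M := by
    rcases le_total t 0 with ht | ht
    · exact hwsq (hw t ht)
    · exact mem_square_of_le hp hL le_rfl hγ (hwsq (hw 0 le_rfl)) ht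
  have hγ' (t : ℝ) : HasDerivAt γ (coneField p L (γ t)) t :=
    clampedField_of_mem (p := p) (L := L) (hsq t) ▸ hγ t
  have hback {t : ℝ} (ht : t ≤ 0) := bounds_of_mem_wedge_backward hk hC hδ0 hδ hCδ
    (fun t _ ↦ hγ' t) h0 hw ht
  refine ⟨M, γ, hγ', hsq, fun t ↦ ?_, fun t ↦ ?_, fun t ht ↦ (hback ht).2.1,
    (k + 1) * Real.exp (1 / 2), by positivity, fun t ht ↦ (hback ht).2.2⟩
  · rcases le_total t 0 with ht | ht
    · exact (hback ht).1
    · refine pos_of_neg_mul_le_deriv (c := 1) (fun s ↦ (hγ' s).coord_fst) (hback le_rfl).1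
        (fun s _ ↦ ?_) ht
      have := (hsq s).2.1
      simp only [coneField]
      linarith
  · rcases le_total t 0 with ht | ht
    · exact (hback ht).1.trans (hback ht).2.1
    · refine pos_of_neg_mul_le_deriv (c := (1 + M ^ 2) * (1 + p))
        (fun s ↦ (hγ' s).coord_snd) ((hback le_rfl).1.trans (hback le_rfl).2.1) (fun s _ ↦ ?_) ht
      obtain ⟨⟨hx, -⟩, hy, hyM⟩ := hsq s
      set x := (γ s).1 with hxdef
      set y := (γ s).2 with hydef
      have hL0 : 0 ≤ L := by linarith
      have hW : 0 < 1 + L * x ^ 2 := by positivity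
      have hquot : -((1 + p) * y) ≤ (p * L * x - (1 + L * x ^ 2 + p) * y) / (1 + L * x ^ 2) := by
        rw [le_div_iff₀ hW]
        have : 0 ≤ p * L * x + p * y * (L * x ^ 2) := by positivity
        linarith
      have h1 : (1 + y ^ 2) * ((1 + p) * y) ≤ (1 + M ^ 2) * ((1 + p) * y) := by gcongr
      have h2 := mul_le_mul_of_nonneg_left hquot (by positivity : 0 ≤ 1 + y ^ 2)
      simp only [coneField, ← hxdef, ← hydef]
      linarith

/-- The density `(1 + L x²)^{p/2}`. -/
noncomputable def weight (p L x : ℝ) : ℝ := Real.exp (p / 2 * Real.log (1 + L * x ^ 2))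

lemma hasDerivAt_weight (p : ℝ) {L : ℝ} (hL : 0 ≤ L) (x : ℝ) :
    HasDerivAt (weight p L) (weight p L x * (p * L * x / (1 + L * x ^ 2))) x := by
  have hW : 1 + L * x ^ 2 ≠ 0 := by positivity
  have h : HasDerivAt (fun x ↦ 1 + L * x ^ 2) (L * (2 * x)) x :=
    (((hasDerivAt_pow 2 x).const_mul L).const_add 1).congr_deriv (by simp)
  refine ((h.log hW).const_mul (p / 2)).exp.congr_deriv ?_
  rw [weight]
  field_simp

lemma weight_pos (p L x : ℝ) : 0 < weight p L x := Real.exp_pos _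

lemma continuous_weight (p : ℝ) {L : ℝ} (hL : 0 ≤ L) : Continuous (weight p L) :=
  continuous_iff_continuousAt.2 fun x ↦ (hasDerivAt_weight p hL x).continuousAt

/-- A Lyapunov function of `coneField`. -/
noncomputable def lyapunov (p L : ℝ) (z : ℝ × ℝ) : ℝ :=
  (p + 2) * (∫ u in (0 : ℝ)..z.1, weight p L u * (u / √(1 + u ^ 2))) -
    weight p L z.1 * ((1 + z.1 * z.2) / √(1 + z.2 ^ 2))

/-- The derivative of `lyapunov` along `coneField`. -/
noncomputable def dissipation (p L : ℝ) (z : ℝ × ℝ) : ℝ :=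
  (p + 2) * weight p L z.1 *
    ((z.2 - z.1) * (z.1 / √(1 + z.1 ^ 2) - z.2 / √(1 + z.2 ^ 2)))

lemma hasDerivAt_sqrt_one_add_sq (x : ℝ) :
    HasDerivAt (fun x ↦ √(1 + x ^ 2)) (x / √(1 + x ^ 2)) x := by
  have h : HasDerivAt (fun x : ℝ ↦ 1 + x ^ 2) (2 * x) x :=
    ((hasDerivAt_pow 2 x).const_add 1).congr_deriv (by simp)
  refine (h.sqrt (by positivity)).congr_deriv ?_
  field_simp

lemma continuous_div_sqrt_one_add_sq : Continuous fun x : ℝ ↦ x / √(1 + x ^ 2) := by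
  have (x : ℝ) : √(1 + x ^ 2) ≠ 0 := by positivity
  fun_prop (disch := exact this _)

lemma strictMono_div_sqrt_one_add_sq : StrictMono fun x : ℝ ↦ x / √(1 + x ^ 2) := by
  intro x y hxy
  simp only [← Real.sin_arctan]
  exact Real.strictMonoOn_sin
    ⟨(Real.neg_pi_div_two_lt_arctan x).le, (Real.arctan_lt_pi_div_two x).le⟩
    ⟨(Real.neg_pi_div_two_lt_arctan y).le, (Real.arctan_lt_pi_div_two y).le⟩
    (Real.arctan_strictMono hxy)

lemma HasDerivAt.lyapunov (p : ℝ) {L : ℝ} (hL : 0 ≤ L) {x y : ℝ → ℝ} {a b t : ℝ}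
    (hx : HasDerivAt x a t) (hy : HasDerivAt y b t) :
    HasDerivAt (fun s ↦ lyapunov p L (x s, y s))
      (weight p L (x t) * (((p + 2) * (x t / √(1 + x t ^ 2)) -
        p * L * x t / (1 + L * x t ^ 2) * ((1 + x t * y t) / √(1 + y t ^ 2)) -
        y t / √(1 + y t ^ 2)) * a + (y t - x t) / (√(1 + y t ^ 2) * (1 + y t ^ 2)) * b)) t := by
  have hR : √(1 + y t ^ 2) ≠ 0 := by positivity
  have hR2 : √(1 + y t ^ 2) ^ 2 = 1 + y t ^ 2 := Real.sq_sqrt (by positivity)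
  have hG : HasDerivAt (fun x ↦ ∫ u in (0 : ℝ)..x, weight p L u * (u / √(1 + u ^ 2)))
      (weight p L (x t) * (x t / √(1 + x t ^ 2))) (x t) :=
    (((continuous_weight p hL).mul continuous_div_sqrt_one_add_sq).integral_hasStrictDerivAt 0
      (x t)).hasDerivAt
  have hquot := ((hx.mul hy).const_add 1).div ((hasDerivAt_sqrt_one_add_sq (y t)).comp t hy) hR
  refine (((hG.comp t hx).const_mul (p + 2)).sub
    (((hasDerivAt_weight p hL (x t)).comp t hx).mul hquot)).congr_deriv ?_
  simp only [Pi.mul_apply, Pi.div_apply, Function.comp_apply]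
  have hW : 1 + L * x t ^ 2 ≠ 0 := by positivity
  have hR1 : √(1 + x t ^ 2) ≠ 0 := by positivity
  generalize √(1 + y t ^ 2) = R at hR hR2 ⊢
  rw [← hR2]
  field_simp
  linear_combination
    (-(weight p L (x t) * √(1 + x t ^ 2) * (1 + x t ^ 2 * L) * b * x t)) * hR2

lemma hasDerivAt_lyapunov_comp (p : ℝ) {L : ℝ} (hL : 0 ≤ L) {γ : ℝ → ℝ × ℝ} {t : ℝ}
    (hγ : HasDerivAt γ (coneField p L (γ t)) t) :
    HasDerivAt (fun s ↦ lyapunov p L (γ s)) (dissipation p L (γ t)) t := by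
  refine (hγ.coord_fst.lyapunov p hL hγ.coord_snd).congr_deriv ?_
  set x := (γ t).1
  set y := (γ t).2
  have hW : 1 + L * x ^ 2 ≠ 0 := by positivity
  have hy : 1 + y ^ 2 ≠ 0 := by positivity
  have hR1 : √(1 + x ^ 2) ≠ 0 := by positivity
  have hR : √(1 + y ^ 2) ≠ 0 := by positivity
  simp only [dissipation, coneField]
  field_simp
  ring

lemma dissipation_nonpos {p : ℝ} (hp : 0 ≤ p) (L : ℝ) (z : ℝ × ℝ) : dissipation p L z ≤ 0 := by
  refine mul_nonpos_of_nonneg_of_nonpos (mul_nonneg (by linarith) (weight_pos p L _).le) ?_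
  rcases le_total z.1 z.2 with h | h
  · have := strictMono_div_sqrt_one_add_sq.monotone h
    exact mul_nonpos_of_nonneg_of_nonpos (by linarith) (by simpa using this)
  · have := strictMono_div_sqrt_one_add_sq.monotone h
    exact mul_nonpos_of_nonpos_of_nonneg (by linarith) (by simpa using this)

lemma dissipation_eq_zero_iff {p : ℝ} (hp : 0 ≤ p) (L : ℝ) (z : ℝ × ℝ) :
    dissipation p L z = 0 ↔ z.2 = z.1 := by
  have h1 : (p + 2) * weight p L z.1 ≠ 0 := mul_ne_zero (by linarith) (weight_pos p L _).ne'
  have h2 : z.1 / √(1 + z.1 ^ 2) = z.2 / √(1 + z.2 ^ 2) ↔ z.1 = z.2 :=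
    strictMono_div_sqrt_one_add_sq.injective.eq_iff
  rw [dissipation, mul_eq_zero_iff_left h1, mul_eq_zero, sub_eq_zero, sub_eq_zero, h2,
    eq_comm (a := z.1), or_self]

lemma continuous_dissipation (p : ℝ) {L : ℝ} (hL : 0 ≤ L) : Continuous (dissipation p L) := by
  have hw := continuous_weight p hL
  have hs := continuous_div_sqrt_one_add_sq
  unfold dissipation
  exact (continuous_const.mul (hw.comp continuous_fst)).mul
    ((continuous_snd.sub continuous_fst).mul ((hs.comp continuous_fst).sub (hs.comp continuous_snd)))

lemma continuous_lyapunov (p : ℝ) {L : ℝ} (hL : 0 ≤ L) : Continuous (lyapunov p L) := by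
  have hG : Continuous fun x ↦ ∫ u in (0 : ℝ)..x, weight p L u * (u / √(1 + u ^ 2)) :=
    intervalIntegral.continuous_primitive
      (fun _ _ ↦ ((continuous_weight p hL).mul continuous_div_sqrt_one_add_sq).intervalIntegrable
        _ _) 0
  have hw := continuous_weight p hL
  have hR (z : ℝ × ℝ) : √(1 + z.2 ^ 2) ≠ 0 := by positivity
  unfold lyapunov
  fun_prop (disch := exact hR _)

lemma hasDerivAt_lyapunov_diag (p : ℝ) {L : ℝ} (hL : 0 ≤ L) (x : ℝ) :
    HasDerivAt (fun x ↦ lyapunov p L (x, x)) (weight p L x * x / (√(1 + x ^ 2) * (1 + L * x ^ 2)) *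
      (L * x ^ 2 - (p * L - p - 1))) x := by
  refine ((hasDerivAt_id x).lyapunov p hL (hasDerivAt_id x)).congr_deriv ?_
  have hW : 1 + L * x ^ 2 ≠ 0 := by positivity
  have hR : √(1 + x ^ 2) ≠ 0 := by positivity
  simp only [id]
  field_simp
  ring

lemma lyapunov_zero (p L : ℝ) : lyapunov p L (0, 0) = -1 := by
  simp [lyapunov, weight]

/-- On the diagonal the Lyapunov function decreases up to the equilibrium. -/
lemma strictAntiOn_lyapunov_diag {p L r : ℝ} (hL : 0 < L) (hr : L * r ^ 2 = p * L - p - 1) :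
    StrictAntiOn (fun x ↦ lyapunov p L (x, x)) (Icc 0 r) := by
  refine strictAntiOn_of_hasDerivWithinAt_neg (convex_Icc 0 r)
    (fun x _ ↦ (hasDerivAt_lyapunov_diag p hL.le x).continuousAt.continuousWithinAt)
    (fun x _ ↦ (hasDerivAt_lyapunov_diag p hL.le x).hasDerivWithinAt) fun x hx ↦ ?_
  rw [interior_Icc] at hx
  have hx0 := hx.1
  have := weight_pos p L x
  refine mul_neg_of_pos_of_neg (by positivity) ?_
  rw [← hr, ← mul_sub]
  exact mul_neg_of_pos_of_neg hL (by nlinarith [hx.2])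

/-- On the diagonal the Lyapunov function increases beyond the equilibrium. -/
lemma strictMonoOn_lyapunov_diag {p L r : ℝ} (hL : 0 < L) (hr0 : 0 ≤ r)
    (hr : L * r ^ 2 = p * L - p - 1) :
    StrictMonoOn (fun x ↦ lyapunov p L (x, x)) (Ici r) := by
  refine strictMonoOn_of_hasDerivWithinAt_pos (convex_Ici r)
    (fun x _ ↦ (hasDerivAt_lyapunov_diag p hL.le x).continuousAt.continuousWithinAt)
    (fun x _ ↦ (hasDerivAt_lyapunov_diag p hL.le x).hasDerivWithinAt) fun x hx ↦ ?_
  rw [interior_Ici] at hx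
  have hx0 : 0 < x := hr0.trans_lt hx
  have hxr : r < x := hx
  have := weight_pos p L x
  refine mul_pos (by positivity) ?_
  rw [← hr, ← mul_sub]
  exact mul_pos hL (by nlinarith)

lemma tendsto_comp_of_isCompact {ι X Y : Type*} [TopologicalSpace X] [TopologicalSpace Y]
    {K : Set X} (hK : IsCompact K) {γ : ι → X} (hγ : ∀ t, γ t ∈ K) {h : X → Y}
    (hh : Continuous h) {l : Filter ι} {y : Y}
    (H : ∀ z ∈ K, ∀ U : Ultrafilter ι, ↑U ≤ l → Tendsto γ U (𝓝 z) → h z = y) :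
    Tendsto (fun t ↦ h (γ t)) l (𝓝 y) := by
  refine (tendsto_iff_ultrafilter _ _ _).2 fun U hU ↦ ?_
  obtain ⟨z, hz, hUz⟩ := hK.ultrafilter_le_nhds (U.map γ)
    (le_principal_iff.2 (Filter.mem_map.2 (univ_mem' hγ)))
  exact H z hz U hU hUz ▸ (hh.tendsto z).comp hUz

lemma uniformContinuous_comp_of_isCompact {K : Set (ℝ × ℝ)} (hK : IsCompact K)
    {γ : ℝ → ℝ × ℝ} (hγ : UniformContinuous γ) (hmem : ∀ t, γ t ∈ K) {g : ℝ × ℝ → ℝ}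
    (hg : Continuous g) : UniformContinuous fun t ↦ g (γ t) :=
  uniformContinuousOn_univ.1 <|
    (hK.uniformContinuousOn_of_continuous hg.continuousOn).comp
      (uniformContinuousOn_univ.2 hγ) fun t _ ↦ hmem t

/-- The second component of the field of (ODE2) in the coordinates `(φ, θ)`. -/
noncomputable def acceleration (p L : ℝ) (z : ℝ × ℝ) : ℝ :=
  (coneField p L z).2 - (coneField p L z).1

lemma continuous_acceleration (p : ℝ) {L : ℝ} (hL : 0 ≤ L) : Continuous (acceleration p L) :=
  (continuous_snd.sub continuous_fst).comp (contDiff_coneField p hL).continuous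

lemma acceleration_eq {p L r : ℝ} (hL : 0 ≤ L) (hr : L * r ^ 2 = p * L - p - 1) (x y : ℝ) :
    acceleration p L (x, y) =
      -(1 + (1 + y ^ 2) * ((1 + L * x ^ 2 + p) / (1 + L * x ^ 2))) * (y - x) -
        (1 + y ^ 2) * (L * x * (x + r) / (1 + L * x ^ 2)) * (x - r) := by
  have hW : 1 + L * x ^ 2 ≠ 0 := by positivity
  simp only [acceleration, coneField]
  field_simp
  linear_combination (-(1 + y ^ 2) * x) * hr

lemma coneField_diag_eq_zero {p L r : ℝ} (hr : L * r ^ 2 = p * L - p - 1) :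
    coneField p L (r, r) = 0 := by
  have : p * L * r - (1 + L * r ^ 2 + p) * r = 0 := by linear_combination (-r) * hr
  simp [coneField, this]

section Orbit

variable {p L M r : ℝ} {γ : ℝ → ℝ × ℝ}

lemma hasDerivAt_velocity (hγ : ∀ t, HasDerivAt γ (coneField p L (γ t)) t) (t : ℝ) :
    HasDerivAt (fun s ↦ (γ s).2 - (γ s).1) (acceleration p L (γ t)) t :=
  (hγ t).coord_snd.sub (hγ t).coord_fst

lemma uniformContinuous_of_mem_square (hL : 0 ≤ L)
    (hγ : ∀ t, HasDerivAt γ (coneField p L (γ t)) t) (hsq : ∀ t, γ t ∈ square M) :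
    UniformContinuous γ := by
  obtain ⟨C, hC⟩ := (isCompact_square M).exists_bound_of_continuousOn
    (contDiff_coneField p hL).continuous.continuousOn
  refine (lipschitzWith_of_nnnorm_deriv_le (C := C.toNNReal)
    (fun t ↦ (hγ t).differentiableAt) fun t ↦ ?_).uniformContinuous
  rw [(hγ t).deriv, ← NNReal.coe_le_coe, coe_nnnorm]
  exact (hC _ (hsq t)).trans (Real.le_coe_toNNReal C)

lemma antitone_lyapunov_comp (hp : 0 ≤ p) (hL : 0 ≤ L)
    (hγ : ∀ t, HasDerivAt γ (coneField p L (γ t)) t) : Antitone fun t ↦ lyapunov p L (γ t) :=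
  antitone_of_hasDerivAt_nonpos (fun t ↦ hasDerivAt_lyapunov_comp p hL (hγ t))
    fun t ↦ dissipation_nonpos hp L (γ t)

lemma lyapunov_lt_of_velocity_ne_zero (hp : 0 ≤ p) (hL : 0 ≤ L)
    (hγ : ∀ t, HasDerivAt γ (coneField p L (γ t)) t) {s t : ℝ} (hst : s < t)
    (h : ∀ u ∈ Ioo s t, (γ u).2 - (γ u).1 ≠ 0) :
    lyapunov p L (γ t) < lyapunov p L (γ s) := by
  have hV (u : ℝ) := hasDerivAt_lyapunov_comp p hL (hγ u)
  refine strictAntiOn_of_hasDerivWithinAt_neg (convex_Icc s t)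
    (fun u _ ↦ (hV u).continuousAt.continuousWithinAt) (fun u _ ↦ (hV u).hasDerivWithinAt)
    (fun u hu ↦ ?_) (left_mem_Icc.2 hst.le) (right_mem_Icc.2 hst.le) hst
  rw [interior_Icc] at hu
  exact (dissipation_nonpos hp L (γ u)).lt_of_ne
    (mt (dissipation_eq_zero_iff hp L _).1 fun he ↦ h u hu (sub_eq_zero.2 he))

/-- An orbit on which the Lyapunov function drops below its value at the origin converges to the
positive equilibrium. -/
lemma tendsto_equilibrium (hp : 0 ≤ p) (hL : 0 < L) (hr0 : 0 < r)
    (hr : L * r ^ 2 = p * L - p - 1) (hγ : ∀ t, HasDerivAt γ (coneField p L (γ t)) t)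
    (hsq : ∀ t, γ t ∈ square M) {t₀ : ℝ} (ht₀ : lyapunov p L (γ t₀) < -1) :
    Tendsto γ atTop (𝓝 (r, r)) := by
  have hK := isCompact_square M
  have hu := uniformContinuous_of_mem_square hL.le hγ hsq
  have hcV := continuous_lyapunov p hL.le
  have hanti := antitone_lyapunov_comp hp hL.le hγ
  have hbdd : BddBelow (range fun t ↦ lyapunov p L (γ t)) :=
    (hK.bddBelow_image hcV.continuousOn).mono
      (range_subset_iff.2 fun t ↦ mem_image_of_mem _ (hsq t))
  have hlim := tendsto_atTop_ciInf hanti hbdd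
  have hlt : ⨅ t, lyapunov p L (γ t) < -1 := (ciInf_le hbdd t₀).trans_lt ht₀
  have hdiss : Tendsto (fun t ↦ dissipation p L (γ t)) atTop (𝓝 0) :=
    tendsto_deriv_zero_of_uniformContinuous (fun t ↦ hasDerivAt_lyapunov_comp p hL.le (hγ t))
      (uniformContinuous_comp_of_isCompact hK hu hsq (continuous_dissipation p hL.le)) hlim
  have hvel : Tendsto (fun t ↦ (γ t).2 - (γ t).1) atTop (𝓝 0) := by
    refine tendsto_comp_of_isCompact hK hsq (continuous_snd.sub continuous_fst)
      fun z _ U hU hz ↦ sub_eq_zero.2 ((dissipation_eq_zero_iff hp L z).1 ?_)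
    exact tendsto_nhds_unique (((continuous_dissipation p hL.le).tendsto z).comp hz)
      (hdiss.mono_left hU)
  have hacc : Tendsto (fun t ↦ acceleration p L (γ t)) atTop (𝓝 0) :=
    tendsto_deriv_zero_of_uniformContinuous (hasDerivAt_velocity hγ)
      (uniformContinuous_comp_of_isCompact hK hu hsq (continuous_acceleration p hL.le)) hvel
  refine tendsto_comp_of_isCompact hK hsq continuous_id fun z hzK U hU hz ↦ ?_
  have hz1 : z.2 - z.1 = 0 := tendsto_nhds_unique
    (((continuous_snd.sub continuous_fst).tendsto z).comp hz) (hvel.mono_left hU)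
  have hz2 : acceleration p L z = 0 := tendsto_nhds_unique
    (((continuous_acceleration p hL.le).tendsto z).comp hz) (hacc.mono_left hU)
  have hz3 : lyapunov p L z = ⨅ t, lyapunov p L (γ t) := tendsto_nhds_unique
    ((hcV.tendsto z).comp hz) (hlim.mono_left hU)
  obtain ⟨x, y⟩ := z
  obtain rfl : y = x := sub_eq_zero.1 hz1
  rw [acceleration_eq hL.le hr, sub_self, mul_zero, zero_sub, neg_eq_zero, mul_eq_zero] at hz2
  have hy : 0 ≤ y := hzK.1.1
  rcases hy.eq_or_lt with rfl | hy
  · rw [lyapunov_zero] at hz3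
    exact absurd hz3 hlt.ne'
  · have hne : (1 + y ^ 2) * (L * y * (y + r) / (1 + L * y ^ 2)) ≠ 0 := by positivity
    rw [id, sub_eq_zero.1 (hz2.resolve_left hne)]

lemma ne_equilibrium (hL : 0 ≤ L) (hr : L * r ^ 2 = p * L - p - 1)
    (hγ : ∀ t, HasDerivAt γ (coneField p L (γ t)) t) (hsq : ∀ t, γ t ∈ square M)
    (h0 : (γ 0).1 < (γ 0).2) (t : ℝ) : γ t ≠ (r, r) := by
  intro ht
  obtain ⟨K, hK⟩ := exists_lipschitzOnWith_coneField p M hL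
  have hconst : γ = fun _ ↦ (r, r) := by
    refine ODE_solution_unique_univ (v := fun _ ↦ coneField p L) (s := fun _ ↦ square M)
      (t₀ := t) (fun _ ↦ hK) (fun s ↦ ⟨hγ s, hsq s⟩) (fun s ↦ ⟨?_, ht ▸ hsq t⟩) ht
    rw [coneField_diag_eq_zero hr]
    exact hasDerivAt_const s _
  rw [hconst] at h0
  exact lt_irrefl _ h0

/-- Where the velocity vanishes, the acceleration has the sign of `r - φ`. -/
lemma acceleration_of_velocity_eq_zero (hL : 0 ≤ L) (hr : L * r ^ 2 = p * L - p - 1) {z : ℝ × ℝ}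
    (hz : z.2 - z.1 = 0) : acceleration p L z =
      (1 + z.2 ^ 2) * (L * z.1 * (z.1 + r) / (1 + L * z.1 ^ 2)) * (r - z.1) := by
  have h := acceleration_eq hL hr z.1 z.2
  rw [hz] at h
  linear_combination h

/-- An orbit converging to a focus has zero velocity at arbitrarily large times. -/
lemma exists_velocity_eq_zero (hp : 0 < p) (hL : 0 < L) (hr0 : 0 < r)
    (hr : L * r ^ 2 = p * L - p - 1)
    (hfocus : (p + 2) ^ 2 * (p * L) < 8 * (p + 1) * (p * L - p - 1))
    (hγ : ∀ t, HasDerivAt γ (coneField p L (γ t)) t)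
    (hlim : Tendsto γ atTop (𝓝 (r, r))) (t₀ : ℝ) : ∃ t, t₀ ≤ t ∧ (γ t).2 - (γ t).1 = 0 := by
  have hW (z : ℝ × ℝ) : 1 + L * z.1 ^ 2 ≠ 0 := by positivity
  have ha : Continuous fun z : ℝ × ℝ ↦
      1 + (1 + z.2 ^ 2) * ((1 + L * z.1 ^ 2 + p) / (1 + L * z.1 ^ 2)) := by
    fun_prop (disch := exact hW _)
  have hb : Continuous fun z : ℝ × ℝ ↦
      (1 + z.2 ^ 2) * (L * z.1 * (z.1 + r) / (1 + L * z.1 ^ 2)) := by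
    fun_prop (disch := exact hW _)
  have hu : Tendsto (fun t ↦ (γ t).1 - r) atTop (𝓝 0) := by
    simpa using ((continuous_fst.tendsto _).comp hlim).sub_const r
  have hWr : 1 + L * r ^ 2 = p * (L - 1) := by linear_combination hr
  have hL1 : 0 < L - 1 := pos_of_mul_pos_right (hWr ▸ by positivity : 0 < p * (L - 1)) hp.le
  have hr2 : L * (1 + r ^ 2) = (p + 1) * (L - 1) := by linear_combination hr
  have hα : 1 + (1 + r ^ 2) * ((1 + L * r ^ 2 + p) / (1 + L * r ^ 2)) = p + 2 := by
    rw [hWr]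
    field_simp
    linear_combination hr2
  have hβ : (1 + r ^ 2) * (L * r * (r + r) / (1 + L * r ^ 2)) =
      2 * (p + 1) * (p * L - p - 1) / (p * L) := by
    rw [hWr, eq_div_iff (by positivity)]
    field_simp
    linear_combination 2 * L * r ^ 2 * hr2 + 2 * (p + 1) * (L - 1) * hr
  refine exists_velocity_zero_of_underdamped (u := fun t ↦ (γ t).1 - r)
    (fun t ↦ (hγ t).coord_fst.sub_const r)
    (fun t ↦ (hasDerivAt_velocity hγ t).congr_deriv (acceleration_eq hL.le hr _ _))
    ((ha.tendsto _).comp hlim) ((hb.tendsto _).comp hlim) ?_ hu t₀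
  simp only [hα, hβ]
  rw [← mul_div_assoc, lt_div_iff₀ (by positivity)]
  linarith

end Orbit

/-- The global picture of the spiralling orbit in the coordinates `(φ, θ)`. -/
lemma exists_spiral_orbit {p k L r : ℝ} (hp : 0 < p) (hk : 3 ≤ k) (hL : 1 ≤ L)
    (hpL : p * L = k * (k + p)) (hr0 : 0 < r) (hr : L * r ^ 2 = p * L - p - 1)
    (hfocus : (p + 2) ^ 2 * (p * L) < 8 * (p + 1) * (p * L - p - 1)) :
    ∃ (γ : ℝ → ℝ × ℝ) (T : ℕ → ℝ), (∀ t, HasDerivAt γ (coneField p L (γ t)) t) ∧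
      Tendsto γ atBot (𝓝 (0, 0)) ∧
      (∃ A > 0, ∀ t ≤ 0, |(γ t).1| ≤ A * Real.exp ((k - 1) * t) ∧
        |(γ t).2 - (γ t).1| ≤ A * Real.exp ((k - 1) * t)) ∧
      Tendsto γ atTop (𝓝 (r, r)) ∧ StrictMono T ∧ Tendsto T atTop atTop ∧
      (∀ i, (γ (T i)).2 - (γ (T i)).1 = 0) ∧
      StrictAnti (fun m : ℕ ↦ (γ (T (2 * m))).1) ∧
      StrictMono (fun m : ℕ ↦ (γ (T (2 * m + 1))).1) ∧
      (∀ t < T 0, 0 < (γ t).2 - (γ t).1) ∧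
      (∀ m : ℕ, ∀ t ∈ Ioo (T (2 * m)) (T (2 * m + 1)), (γ t).2 - (γ t).1 < 0) ∧
      (∀ m : ℕ, ∀ t ∈ Ioo (T (2 * m + 1)) (T (2 * m + 2)), 0 < (γ t).2 - (γ t).1) ∧
      ∀ t, 0 < (γ t).2 := by
  obtain ⟨M, γ, hγ, hsq, hφ, hθ, hstart, A, hA, hbound⟩ := exists_unstable_curve hp.le hk hL hpL
  have hL0 : 0 < L := by linarith
  have hdecay (t : ℝ) (ht : t ≤ 0) : |(γ t).1| ≤ A * Real.exp ((k - 1) * t) ∧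
      |(γ t).2 - (γ t).1| ≤ A * Real.exp ((k - 1) * t) := by
    have h1 := hφ t
    have h2 := hstart t ht
    rw [abs_of_pos h1, abs_of_pos (by linarith)]
    exact ⟨(hbound t ht).1, by linarith [(hbound t ht).2]⟩
  have hexp : Tendsto (fun t ↦ A * Real.exp ((k - 1) * t)) atBot (𝓝 0) := by
    simpa using (Real.tendsto_exp_atBot.comp
      (tendsto_id.const_mul_atBot (by linarith : 0 < k - 1))).const_mul A
  have hbot : Tendsto γ atBot (𝓝 (0, 0)) :=
    (squeeze_zero' (Eventually.of_forall fun t ↦ (hφ t).le)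
      ((eventually_le_atBot 0).mono fun t ht ↦ (hbound t ht).1) hexp).prodMk_nhds
    (squeeze_zero' (Eventually.of_forall fun t ↦ (hθ t).le)
      ((eventually_le_atBot 0).mono fun t ht ↦ (hbound t ht).2) hexp)
  have hVbot : Tendsto (fun t ↦ lyapunov p L (γ t)) atBot (𝓝 (-1)) := by
    rw [← lyapunov_zero p L]
    exact ((continuous_lyapunov p hL0.le).tendsto (0, 0)).comp hbot
  have hV0 : lyapunov p L (γ 0) < -1 :=
    (lyapunov_lt_of_velocity_ne_zero hp.le hL0.le hγ (neg_one_lt_zero (R := ℝ))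
      fun u hu ↦ (sub_pos.2 (hstart u hu.2.le)).ne').trans_le
      ((antitone_lyapunov_comp hp.le hL0.le hγ).ge_of_tendsto hVbot (-1))
  have hlim := tendsto_equilibrium hp.le hL0 hr0 hr hγ hsq hV0
  have hsign (z : ℝ × ℝ) (hz1 : 0 < z.1) :
      0 < (1 + z.2 ^ 2) * (L * z.1 * (z.1 + r) / (1 + L * z.1 ^ 2)) := by positivity
  have hsimple (t : ℝ) (ht : (γ t).2 - (γ t).1 = 0) : acceleration p L (γ t) ≠ 0 := by
    rw [acceleration_of_velocity_eq_zero hL0.le hr ht]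
    refine mul_ne_zero (hsign _ (hφ t)).ne' fun h ↦ ?_
    refine ne_equilibrium hL0.le hr hγ hsq (hstart 0 le_rfl) t (Prod.ext ?_ ?_) <;>
      simp only <;> linarith
  obtain ⟨T, hT, hTtop, hT0, hfirst, hneg, hpos⟩ := exists_zero_sequence (hasDerivAt_velocity hγ)
    (fun t ht ↦ sub_pos.2 (hstart t ht)) hsimple
    (exists_velocity_eq_zero hp hL0 hr0 hr hfocus hγ hlim)
  have hdiag (i : ℕ) : γ (T i) = ((γ (T i)).1, (γ (T i)).1) :=
    Prod.ext rfl (sub_eq_zero.1 (hT0 i))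
  have hne (i : ℕ) (u : ℝ) (hu : u ∈ Ioo (T i) (T (i + 1))) : (γ u).2 - (γ u).1 ≠ 0 := by
    obtain ⟨m, rfl | rfl⟩ := i.even_or_odd'
    · exact ((hneg m).2 u hu).ne
    · exact ((hpos m).2 u hu).ne'
  have hVT : StrictAnti fun i ↦ lyapunov p L ((γ (T i)).1, (γ (T i)).1) :=
    strictAnti_nat_of_succ_lt fun i ↦ by
      simpa only [← hdiag] using lyapunov_lt_of_velocity_ne_zero hp.le hL0.le hγ
        (hT i.lt_succ_self) (hne i)
  have heven (m : ℕ) : r < (γ (T (2 * m))).1 := by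
    have h := (hneg m).1
    rw [acceleration_of_velocity_eq_zero hL0.le hr (hT0 _)] at h
    linarith [neg_of_mul_neg_right h (hsign _ (hφ _)).le]
  have hodd (m : ℕ) : (γ (T (2 * m + 1))).1 < r := by
    have h := (hpos m).1
    rw [acceleration_of_velocity_eq_zero hL0.le hr (hT0 _)] at h
    linarith [pos_of_mul_pos_right h (hsign _ (hφ _)).le]
  refine ⟨γ, T, hγ, hbot, ⟨A, hA, hdecay⟩, hlim, hT, hTtop, hT0, fun m m' hm ↦ ?_,
    fun m m' hm ↦ ?_, hfirst, fun m ↦ (hneg m).2, fun m ↦ (hpos m).2, hθ⟩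
  · exact ((strictMonoOn_lyapunov_diag hL0 hr0.le hr).lt_iff_lt (heven m').le (heven m).le).1
      (hVT (by lia))
  · exact ((strictAntiOn_lyapunov_diag hL0 hr).lt_iff_gt ⟨(hφ _).le, (hodd m').le⟩
      ⟨(hφ _).le, (hodd m).le⟩).1 (hVT (by lia))

/-- The second component of (ODE2) in the coordinates `(φ, θ)`. -/
lemma X2_eq_acceleration {n p : ℕ} (hn : (n : ℝ) = p + 1) {lam L : ℝ} (hL : lam ^ 2 = L)
    (z : ℝ × ℝ) : X2 n p lam z.1 (z.2 - z.1) = acceleration p L z := by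
  subst hL
  have hW : 1 + lam ^ 2 * z.1 ^ 2 ≠ 0 := by positivity
  simp only [X2, f1, f2, hn, acceleration, coneField, add_sub_cancel_left, add_sub_cancel]
  field_simp
  ring

end

/-- Proposition 3.5 of Xu–Yang–Zhang (Type (II) cases): existence of a global
solution of (ODE2) emanating from the saddle `(0,0)` (with decay `O(e^{(k-1)t})`
at `-∞`) and spiralling into the stable spiral point `(φ₀,0)`.  Here the
sequence `T` is 0-indexed: `T i` stands for `T_{i+1}` of the paper. -/
theorem ode2_spiral_type_II (n p k : ℕ)
    (h : ((n, p) = (3, 2) ∧ 4 ≤ k) ∨ ((n, p) = (5, 4) ∧ 6 ≤ k))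
    (lam φ₀ : ℝ)
    (hlam : lam = Real.sqrt ((k : ℝ) * ((k : ℝ) + n - 1) / p))
    (hφ₀ : φ₀ = Real.sqrt (((p : ℝ) - n / lam ^ 2) / ((n : ℝ) - p))) :
    ∃ (φ ψ : ℝ → ℝ) (T : ℕ → ℝ),
      (∀ t : ℝ, HasDerivAt φ (ψ t) t ∧
        HasDerivAt ψ (X2 n p lam (φ t) (ψ t)) t) ∧
      StrictMono T ∧
      Filter.Tendsto (fun t => (φ t, ψ t)) Filter.atBot (nhds (0, 0)) ∧
      (∃ C > (0 : ℝ), ∃ T₀ : ℝ, ∀ t ≤ T₀,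
        |φ t| ≤ C * Real.exp (((k : ℝ) - 1) * t) ∧
        |ψ t| ≤ C * Real.exp (((k : ℝ) - 1) * t)) ∧
      Filter.Tendsto (fun t => (φ t, ψ t)) Filter.atTop (nhds (φ₀, 0)) ∧
      Filter.Tendsto T Filter.atTop Filter.atTop ∧
      (∀ i : ℕ, ψ (T i) = 0) ∧
      StrictAnti (fun m : ℕ => φ (T (2 * m))) ∧
      StrictMono (fun m : ℕ => φ (T (2 * m + 1))) ∧
      Filter.Tendsto (fun m : ℕ => φ (T (2 * m))) Filter.atTop (nhds φ₀) ∧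
      Filter.Tendsto (fun m : ℕ => φ (T (2 * m + 1))) Filter.atTop (nhds φ₀) ∧
      (∀ t : ℝ, t < T 0 → 0 < ψ t) ∧
      (∀ m : ℕ, ∀ t : ℝ, T (2 * m + 1) < t → t < T (2 * m + 2) → 0 < ψ t) ∧
      (∀ m : ℕ, ∀ t : ℝ, T (2 * m) < t → t < T (2 * m + 1) → ψ t < 0) ∧
      (∀ t : ℝ, 0 < φ t + ψ t) := by
  obtain ⟨hn, hp, hk, hfoc⟩ : (n : ℝ) = p + 1 ∧ (0 : ℝ) < p ∧ (3 : ℝ) ≤ k ∧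
      ((p : ℝ) + 2) ^ 2 * (k * (k + p)) < 8 * (p + 1) * (k * (k + p) - p - 1) := by
    rcases h with ⟨h, hk⟩ | ⟨h, hk⟩ <;> obtain ⟨rfl, rfl⟩ := Prod.mk.inj h
    · have hk : (4 : ℝ) ≤ k := mod_cast hk
      refine ⟨by norm_num, by norm_num, by linarith, ?_⟩
      push_cast
      nlinarith
    · have hk : (6 : ℝ) ≤ k := mod_cast hk
      refine ⟨by norm_num, by norm_num, by linarith, ?_⟩
      push_cast
      nlinarith
  have hlam2 : lam ^ 2 = k * (k + p) / p := by
    rw [hlam, Real.sq_sqrt] <;> rw [hn, add_sub_assoc, add_sub_cancel_right]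
    positivity
  have hpL : (p : ℝ) * lam ^ 2 = k * (k + p) := by
    rw [hlam2]
    field_simp
  have hL : 1 ≤ lam ^ 2 := by
    rw [hlam2, one_le_div hp]
    nlinarith
  have hL0 : 0 < lam ^ 2 := by linarith
  have hpos : 0 < (p : ℝ) - n / lam ^ 2 := by
    rw [sub_pos, div_lt_iff₀ hL0, hpL, hn]
    nlinarith
  have hden : (n : ℝ) - p = 1 := by linarith
  rw [hden, div_one] at hφ₀
  have hφ₀pos : 0 < φ₀ := hφ₀ ▸ Real.sqrt_pos.2 hpos
  have hφ₀sq : lam ^ 2 * φ₀ ^ 2 = p * lam ^ 2 - p - 1 := by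
    rw [hφ₀, Real.sq_sqrt hpos.le, hn, mul_sub, mul_div_cancel₀ _ hL0.ne']
    ring
  obtain ⟨γ, T, hγ, hbot, ⟨A, hA, hdecay⟩, hlim, hT, hTtop, hT0, heven, hodd, hfirst, hneg, hpos',
      hθ⟩ :=
    exists_spiral_orbit hp hk hL hpL hφ₀pos hφ₀sq (by rwa [hpL])
  have hcont : Continuous fun z : ℝ × ℝ ↦ (z.1, z.2 - z.1) := by fun_prop
  have htop : Filter.Tendsto (fun t ↦ ((γ t).1, (γ t).2 - (γ t).1)) Filter.atTop
      (nhds (φ₀, 0)) := by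
    simpa only [sub_self, Function.comp_def] using (hcont.tendsto (φ₀, φ₀)).comp hlim
  have hφ : Filter.Tendsto (fun t ↦ (γ t).1) Filter.atTop (nhds φ₀) :=
    (continuous_fst.tendsto _).comp hlim
  have hsub (c : ℕ) : Filter.Tendsto (fun m : ℕ ↦ (γ (T (2 * m + c))).1) Filter.atTop (nhds φ₀) :=
    hφ.comp <| hTtop.comp <| StrictMono.tendsto_atTop fun a b hab ↦ by lia
  refine ⟨fun t ↦ (γ t).1, fun t ↦ (γ t).2 - (γ t).1, T, fun t ↦ ⟨(hγ t).coord_fst, ?_⟩, hT, ?_,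
    ⟨A, hA, 0, hdecay⟩, htop, hTtop, hT0, heven, hodd,
    hsub 0, hsub 1, hfirst, fun m t h1 h2 ↦ hpos' m t ⟨h1, h2⟩, fun m t h1 h2 ↦ hneg m t ⟨h1, h2⟩,
    fun t ↦ by simpa using hθ t⟩
  · exact (hasDerivAt_velocity hγ t).congr_deriv (X2_eq_acceleration hn rfl _).symm
  · simpa only [sub_self, Function.comp_def] using (hcont.tendsto (0, 0)).comp hbot
end

section
/- Let n > p ≥ 1 be integers and λ > 0 a real number. Then for all real numbers φ and ψ with ψ > 0 and 3(n−p)·φ² ≥ 3p − n − 1, one has −2ψ − 2·f₂(φ)·ψ·(1 + φ² + ψ²) + 4·f₁(φ)·φ²·ψ < 0. -/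
/-- The key inequality (⋆) in the proof of Lemma A.1, Appendix A.4 of
Xu–Yang–Zhang: `X₂(φ,ψ) + Y₂(φ,ψ) = -2ψ - 2f₂(φ)ψ(1+φ²+ψ²) + 4f₁(φ)φ²ψ < 0`
whenever `ψ > 0` and `3(n-p)φ² ≥ 3p-n-1`. -/
theorem key_inequality_star (n p : ℕ) (hp : 1 ≤ p) (hnp : p < n)
    (lam : ℝ) (hlam : 0 < lam) :
    ∀ φ ψ : ℝ, 0 < ψ → 3 * (p : ℝ) - n - 1 ≤ 3 * ((n : ℝ) - p) * φ ^ 2 →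
      -2 * ψ - 2 * f2 n p lam φ * ψ * (1 + φ ^ 2 + ψ ^ 2)
        + 4 * f1 n p lam φ * φ ^ 2 * ψ < 0 := by
  intro φ ψ hψ h
  have hp' : (0 : ℝ) < p := by exact_mod_cast hp
  have hk : (0 : ℝ) < (n : ℝ) - p := sub_pos.mpr (by exact_mod_cast hnp)
  have hD : 0 < 1 + lam ^ 2 * φ ^ 2 := by positivity
  have hf2 : 0 < f2 n p lam φ := by
    unfold f2
    positivity
  have key : -2 * ψ - 2 * f2 n p lam φ * ψ * (1 + φ ^ 2 + ψ ^ 2)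
        + 4 * f1 n p lam φ * φ ^ 2 * ψ
      = -(2 * ψ * ((3 * ((n : ℝ) - p) * φ ^ 2 - (3 * (p : ℝ) - n - 1))
        + 3 * p * (1 + φ ^ 2) / (1 + lam ^ 2 * φ ^ 2) + f2 n p lam φ * ψ ^ 2)) := by
    unfold f1 f2
    field_simp
    ring
  rw [key, neg_lt_zero]
  have h' := sub_nonneg.mpr h
  positivity
end

section
/- Suppose (n, p, k) = (3,2,2) or (5,4,2) with c = 1, or (n, p, k) = (5,4,4) with c = 6/7, or n ≥ 7 with p < n < 2p, p ≥ 4, k ≥ 2 and c = 1/2. Let λ = √(k(k+n−1)/p), φ₀ = √((p − n/λ²)/(n−p)), and define h(φ) = f₁(φ)·φ/(c(n−p)). Then for every φ ∈ (0, φ₀): h'(φ) + 1 + (f₂(φ) − c(n−p)) · (1 + (φ + h(φ))²) > 0. Equivalently, since h(φ) > 0 on (0, φ₀), the vector field X of (ODE2) satisfies h'(φ) > X₂(φ, h(φ))/X₁(φ, h(φ)) on (0, φ₀), so X points inward along the graph of h. -/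
/-- The barrier function `h(φ) = f₁(φ)·φ/(c(n-p))` of Appendix A.3. -/
noncomputable def hbar (n p : ℕ) (lam c φ : ℝ) : ℝ :=
  f1 n p lam φ * φ / (c * ((n : ℝ) - p))

/-- Derivative of the barrier function, with `s = 1 + λ²φ²`. -/
lemma hasDerivAt_hbar (n p : ℕ) (lam c φ : ℝ) :
    HasDerivAt (hbar n p lam c)
      (((lam ^ 2 - 1) * p * (2 - (1 + lam ^ 2 * φ ^ 2)) / (1 + lam ^ 2 * φ ^ 2) ^ 2 -
        ((n : ℝ) - p)) / (c * ((n : ℝ) - p))) φ := by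
  have hs : 1 + lam ^ 2 * φ ^ 2 ≠ 0 := by positivity
  have hd : HasDerivAt (fun x : ℝ => 1 + lam ^ 2 * x ^ 2) (lam ^ 2 * (2 * φ)) φ := by
    simpa using ((hasDerivAt_pow 2 φ).const_mul (lam ^ 2)).const_add 1
  have hf : HasDerivAt (f1 n p lam) _ φ :=
    ((hasDerivAt_const φ ((lam ^ 2 - 1) * (p : ℝ))).div hd hs).sub_const ((n : ℝ) - p)
  refine ((hf.mul (hasDerivAt_id φ)).div_const (c * ((n : ℝ) - p))).congr_deriv ?_
  congr 1
  simp only [f1, id]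
  field_simp
  ring

/-- A quadratic estimate, linear in `v`, behind the barrier inequality with `c = 1 / 2`. -/
lemma barrier_quadratic_pos {p q u v : ℝ} (hp : 4 ≤ p) (hpq : 7 ≤ p + q)
    (hu : 1 ≤ u) (hv : 0 ≤ v) (hv1 : v ≤ 1) :
    0 < 4 * u * v - 2 * u - 1 + q / 2 + p * v + p * (1 - v) / (2 * u) * (2 * u - 1) ^ 2 := by
  have h1 : 0 < 2 * u - 1 + q / 2 + p := by linarith
  have h0 : 0 < -2 * u - 1 + q / 2 + p * (2 * u - 1) ^ 2 / (2 * u) := by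
    have : -2 * u - 1 + q / 2 + p * (2 * u - 1) ^ 2 / (2 * u) =
        ((p + q - 6) + (4 * p + q - 10) * (u - 1) + (4 * p - 4) * (u - 1) ^ 2) / (2 * u) := by
      field_simp
      ring
    rw [this]
    have h2 : 0 ≤ (4 * p + q - 10) * (u - 1) := mul_nonneg (by linarith) (by linarith)
    have h3 : 0 ≤ (4 * p - 4) * (u - 1) ^ 2 := mul_nonneg (by linarith) (sq_nonneg _)
    exact div_pos (by linarith) (by linarith)
  have key : 4 * u * v - 2 * u - 1 + q / 2 + p * v + p * (1 - v) / (2 * u) * (2 * u - 1) ^ 2 =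
      v * (2 * u - 1 + q / 2 + p) +
        (1 - v) * (-2 * u - 1 + q / 2 + p * (2 * u - 1) ^ 2 / (2 * u)) := by
    ring
  rw [key]
  rcases hv.eq_or_lt with rfl | hv
  · simpa using h0
  · exact add_pos_of_pos_of_nonneg (mul_pos hv h1) (mul_nonneg (by linarith) h0.le)

/-- The barrier inequality for `c = 1 / 2`, in the variable `s = 1 + λ²φ²` with `L = λ²`. -/
lemma barrier_half {p q L s : ℝ} (hp : 4 ≤ p) (hq : 0 < q) (hpq : 7 ≤ p + q) (hL : 0 < L)
    (hs : 1 < s) (hsA : q * s < (L - 1) * p) :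
    0 < ((L - 1) * p * (2 - s) / s ^ 2 - q) / (1 / 2 * q) + 1 + (q + p / s - 1 / 2 * q) *
      (1 + (s - 1) / L * (((L - 1) * p / s - (1 - 1 / 2) * q) / (1 / 2 * q)) ^ 2) := by
  obtain ⟨u, hu⟩ : ∃ u, u = (L - 1) * p / (q * s) := ⟨_, rfl⟩
  have hs0 : 0 < s := by linarith
  have hu1 : 1 < u := by rw [hu, lt_div_iff₀ (by positivity)]; linarith
  have hA : (L - 1) * p = u * (q * s) := by rw [hu]; field_simp
  have hv1 : 1 / s ≤ 1 := by rw [div_le_one hs0]; exact hs.le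
  have hquad := barrier_quadratic_pos hp hpq hu1.le (by positivity : 0 ≤ 1 / s) hv1
  have hcoef : p * (1 - 1 / s) / (2 * u) ≤ (q / 2 + p / s) * ((s - 1) / L) := by
    have e : (q / 2 + p / s) * ((s - 1) / L) - p * (1 - 1 / s) / (2 * u) =
        (s - 1) * (q * s * u + 2 * p * u - p * L) / (2 * u * s * L) := by
      field_simp
    have e2 : q * s * u + 2 * p * u - p * L = p * (2 * u - 1) := by linarith
    have : 0 ≤ (s - 1) * (p * (2 * u - 1)) / (2 * u * s * L) :=
      div_nonneg (mul_nonneg (by linarith) (mul_nonneg (by linarith) (by linarith)))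
        (by positivity)
    rw [e2] at e
    linarith
  have hmul := mul_le_mul_of_nonneg_right hcoef (sq_nonneg (2 * u - 1))
  rw [hA]
  have e : (u * (q * s) * (2 - s) / s ^ 2 - q) / (1 / 2 * q) + 1 + (q + p / s - 1 / 2 * q) *
      (1 + (s - 1) / L * ((u * (q * s) / s - (1 - 1 / 2) * q) / (1 / 2 * q)) ^ 2) =
      4 * u * (1 / s) - 2 * u - 1 + q / 2 + p * (1 / s) +
        (q / 2 + p / s) * ((s - 1) / L) * (2 * u - 1) ^ 2 := by
    field_simp
    ring
  rw [e]
  linarith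

/-- The barrier inequality in the variable `s = 1 + λ²φ²`, in all the cases considered. -/
lemma barrier_in_s (n p k : ℕ) (c : ℝ)
    (h : (((n, p, k) = (3, 2, 2) ∨ (n, p, k) = (5, 4, 2)) ∧ c = 1) ∨
      ((n, p, k) = (5, 4, 4) ∧ c = 6 / 7) ∨
      (7 ≤ n ∧ p < n ∧ n < 2 * p ∧ 4 ≤ p ∧ 2 ≤ k ∧ c = 1 / 2))
    {L s : ℝ} (hL : L = (k : ℝ) * ((k : ℝ) + n - 1) / p) (hL0 : 0 < L) (hs : 1 < s)
    (hsA : ((n : ℝ) - p) * s < (L - 1) * p) :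
    0 < ((L - 1) * p * (2 - s) / s ^ 2 - ((n : ℝ) - p)) / (c * ((n : ℝ) - p)) + 1 +
      (((n : ℝ) - p) + p / s - c * ((n : ℝ) - p)) * (1 + (s - 1) / L *
        (((L - 1) * p / s - (1 - c) * ((n : ℝ) - p)) / (c * ((n : ℝ) - p))) ^ 2) := by
  have hs0 : 0 < s := by linarith
  rcases h with ⟨h | h, rfl⟩ | ⟨h, rfl⟩ | ⟨hn, hpn, -, hp, -, rfl⟩
  · simp only [Prod.mk.injEq] at h
    obtain ⟨rfl, rfl, rfl⟩ := h
    norm_num at hL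
    subst hL
    norm_num at hsA ⊢
    refine lt_of_lt_of_eq
      (div_pos (by nlinarith : 0 < -4 * s ^ 2 + 30 * s - 18) (pow_pos hs0 3)) ?_
    field_simp
    ring
  · simp only [Prod.mk.injEq] at h
    obtain ⟨rfl, rfl, rfl⟩ := h
    norm_num at hL
    subst hL
    norm_num at hsA ⊢
    refine lt_of_lt_of_eq
      (div_pos (by nlinarith : 0 < 16 * s - 4 * s ^ 2 + 256 / 3 * (s - 1)) (pow_pos hs0 3)) ?_
    field_simp
    ring
  · simp only [Prod.mk.injEq] at h
    obtain ⟨rfl, rfl, rfl⟩ := h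
    norm_num at hL
    subst hL
    norm_num at hsA ⊢
    have hs28 : 0 < 28 - s := by linarith
    have hcubic : 0 < -38416 + 40768 * s + 385 * s ^ 2 - s ^ 3 := by
      nlinarith [mul_pos (mul_pos hs0 hs0) hs28]
    refine lt_of_lt_of_eq (div_pos (mul_pos hs28 hcubic)
      (by positivity : 0 < 2016 * s ^ 3)) ?_
    field_simp
    ring
  · have hq : (0 : ℝ) < (n : ℝ) - p := by
      have : (p : ℝ) < n := by exact_mod_cast hpn
      linarith
    have hn' : (7 : ℝ) ≤ n := by exact_mod_cast hn
    exact barrier_half (by exact_mod_cast hp) hq (by linarith) hL0 hs hsA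

/-- The barrier inequality (B) of Appendix A.3 of Xu–Yang–Zhang: in the Type (I)
cases with the indicated choice of `c`, the vector field `X` of (ODE2) points
inward along the graph of `h` over `(0, φ₀)`, i.e.
`h'(φ) + 1 + (f₂(φ) - c(n-p))(1 + (φ + h(φ))²) > 0`; equivalently, since
`h(φ) > 0` there, `h'(φ) > X₂(φ,h(φ))/X₁(φ,h(φ))`. -/
theorem barrier_inequality_type_I (n p k : ℕ) (c : ℝ)
    (h : (((n, p, k) = (3, 2, 2) ∨ (n, p, k) = (5, 4, 2)) ∧ c = 1) ∨
      ((n, p, k) = (5, 4, 4) ∧ c = 6 / 7) ∨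
      (7 ≤ n ∧ p < n ∧ n < 2 * p ∧ 4 ≤ p ∧ 2 ≤ k ∧ c = 1 / 2))
    (lam φ₀ : ℝ)
    (hlam : lam = Real.sqrt ((k : ℝ) * ((k : ℝ) + n - 1) / p))
    (hφ₀ : φ₀ = Real.sqrt (((p : ℝ) - n / lam ^ 2) / ((n : ℝ) - p))) :
    ∀ φ : ℝ, 0 < φ → φ < φ₀ →
      0 < deriv (hbar n p lam c) φ + 1 +
          (f2 n p lam φ - c * ((n : ℝ) - p)) * (1 + (φ + hbar n p lam c φ) ^ 2) ∧
      0 < hbar n p lam c φ ∧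
      X2 n p lam φ (hbar n p lam c φ) / hbar n p lam c φ <
        deriv (hbar n p lam c) φ := by
  intro φ hφ hφlt
  obtain ⟨hp0, hpn, hk⟩ : 0 < p ∧ p < n ∧ 0 < k := by
    rcases h with ⟨h | h, -⟩ | ⟨h, -⟩ | h
    all_goals first | omega | (simp only [Prod.mk.injEq] at h; omega)
  have hc : 0 < c := by
    rcases h with ⟨-, rfl⟩ | ⟨-, rfl⟩ | ⟨-, -, -, -, -, rfl⟩ <;> norm_num
  have hp : (0 : ℝ) < p := by exact_mod_cast hp0
  have hq : (0 : ℝ) < (n : ℝ) - p := sub_pos.2 (by exact_mod_cast hpn)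
  have hn : (1 : ℝ) ≤ n := by exact_mod_cast (by omega : 1 ≤ n)
  have hk' : (0 : ℝ) < k := by exact_mod_cast hk
  have hpos : 0 < (k : ℝ) * ((k : ℝ) + n - 1) / p :=
    div_pos (mul_pos hk' (by linarith)) hp
  have hL : lam ^ 2 = (k : ℝ) * ((k : ℝ) + n - 1) / p := by rw [hlam, Real.sq_sqrt hpos.le]
  have hL0 : 0 < lam ^ 2 := hL ▸ hpos
  have hs : 1 < 1 + lam ^ 2 * φ ^ 2 := by
    have : 0 < lam ^ 2 * φ ^ 2 := by positivity
    linarith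
  have hsA : ((n : ℝ) - p) * (1 + lam ^ 2 * φ ^ 2) < (lam ^ 2 - 1) * p := by
    rw [hφ₀, Real.lt_sqrt hφ.le, lt_div_iff₀ hq, lt_sub_iff_add_lt] at hφlt
    have := mul_lt_mul_of_pos_right hφlt hL0
    rw [add_mul, div_mul_cancel₀ _ hL0.ne'] at this
    linarith
  have hf1 : 0 < f1 n p lam φ := by
    rw [f1, sub_pos, lt_div_iff₀ (by linarith)]
    exact hsA
  have hh : 0 < hbar n p lam c φ := div_pos (mul_pos hf1 hφ) (mul_pos hc hq)
  have hB : 0 < deriv (hbar n p lam c) φ + 1 +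
      (f2 n p lam φ - c * ((n : ℝ) - p)) * (1 + (φ + hbar n p lam c φ) ^ 2) := by
    have key := barrier_in_s n p k c h hL hL0 hs hsA
    rw [add_sub_cancel_left, mul_div_cancel_left₀ _ hL0.ne'] at key
    have e : φ + hbar n p lam c φ = φ * (((lam ^ 2 - 1) * p / (1 + lam ^ 2 * φ ^ 2) -
        (1 - c) * ((n : ℝ) - p)) / (c * ((n : ℝ) - p))) := by
      rw [hbar, f1]
      field_simp
      ring
    rwa [(hasDerivAt_hbar n p lam c φ).deriv, e, mul_pow, f2]
  refine ⟨hB, hh, ?_⟩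
  have hrel : f1 n p lam φ * φ = c * ((n : ℝ) - p) * hbar n p lam c φ := by
    rw [hbar, mul_div_cancel₀ _ (mul_pos hc hq).ne']
  rw [X2, hrel, div_lt_iff₀ hh]
  linarith [mul_pos hB hh]
end

section
/- For every real number s > 0, (4/25) · ((3+5s)/(1+s))² · (1+5s)/(1+10s) ≥ 32/27, with equality if and only if s = 1/5. -/
/-- The minimization lemma of Step 1 in Appendix A.4 of Xu–Yang–Zhang:
`F(s) = (4/25)·((3+5s)/(1+s))²·(1+5s)/(1+10s) ≥ 32/27` for all `s > 0`,
with equality exactly at `s = 1/5`. -/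
theorem F_min_value (s : ℝ) (hs : 0 < s) :
    32 / 27 ≤ 4 / 25 * ((3 + 5 * s) / (1 + s)) ^ 2 * (1 + 5 * s) / (1 + 10 * s) ∧
    (4 / 25 * ((3 + 5 * s) / (1 + s)) ^ 2 * (1 + 5 * s) / (1 + 10 * s) = 32 / 27 ↔
      s = 1 / 5) := by
  have key : 4 / 25 * ((3 + 5 * s) / (1 + s)) ^ 2 * (1 + 5 * s) / (1 + 10 * s) - 32 / 27 =
      4 * (55 * s + 43) / (675 * (1 + s) ^ 2 * (1 + 10 * s)) * (5 * s - 1) ^ 2 := by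
    field_simp
    ring
  have hpos : 0 < 4 * (55 * s + 43) / (675 * (1 + s) ^ 2 * (1 + 10 * s)) := by positivity
  constructor
  · rw [← sub_nonneg, key]
    positivity
  · rw [← sub_eq_zero, key, mul_eq_zero_iff_left hpos.ne', sq_eq_zero_iff]
    constructor <;> intro h <;> linarith
end
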